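/- arXiv:math/9811131 — 3 statements merged into one kernel-verified Lean document; each statement's English description precedes it below -/
import Mathlib

section
/- Suppose n ≥ 2 and d ≥ 3. Then there exist integers i with 1 ≤ i ≤ 3d−2 and q ≥ 2 such that the Veronese–Koszul complex at (i,q) is not exact. (Equivalently, the Veronese embedding φ_{O(d)} : P^n ↪ P^N does not satisfy property N_{3d−2}.) -/
open TensorProduct

noncomputable section

variable (K : Type*) [Field K]

/-- `S K n e` is the space of homogeneous polynomials of degree `e`
in the `n+1` variables `x_0, …, x_n`. -/
abbrev S (n e : ℕ) : Submodule K (MvPolynomial (Fin (n + 1)) K) :=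
  MvPolynomial.homogeneousSubmodule (Fin (n + 1)) K e

/-- The product of a homogeneous polynomial of degree `d` with one of degree `b`,
viewed as an element of degree `b + d`. -/
def mulSW {n d b : ℕ} (s : S K n d) (w : S K n b) : S K n (b + d) :=
  ⟨(s : MvPolynomial (Fin (n + 1)) K) * (w : MvPolynomial (Fin (n + 1)) K), by
    rw [MvPolynomial.mem_homogeneousSubmodule, Nat.add_comm b d]
    exact ((MvPolynomial.mem_homogeneousSubmodule _ _).1 s.2).mul
      ((MvPolynomial.mem_homogeneousSubmodule _ _).1 w.2)⟩

/-- Identification of spaces of homogeneous polynomials of equal degrees. -/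
def scast {n e₁ e₂ : ℕ} (h : e₁ = e₂) : S K n e₁ ≃ₗ[K] S K n e₂ :=
  LinearEquiv.ofEq _ _ (by rw [h])

/-- The increasing injection `Fin (a-1) → Fin a` omitting `j`. -/
def skipAt {a : ℕ} (j : Fin a) (i : Fin (a - 1)) : Fin a :=
  if (i : ℕ) < (j : ℕ) then ⟨i, by have := i.isLt; omega⟩
  else ⟨(i : ℕ) + 1, by have := i.isLt; omega⟩

/-- The wedge `v 0 ∧ ⋯ ∧ v (a-1)` as an element of the `a`-th exterior power. -/
def wedge {M : Type*} [AddCommGroup M] [Module K M] (a : ℕ) (v : Fin a → M) :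
    ⋀[K]^a M :=
  ⟨ExteriorAlgebra.ιMulti K a v, ExteriorAlgebra.ιMulti_range K a ⟨v, rfl⟩⟩

/-- `IsKoszulMap K n d a b δ` says that `δ : ⋀^a S_d ⊗ S_b → ⋀^{a-1} S_d ⊗ S_{b+d}` is
the Koszul map, i.e. it satisfies
`δ((s_1 ∧ ⋯ ∧ s_a) ⊗ w) = Σ_j (−1)^{j−1} (s_1 ∧ ⋯ ∧ ŝ_j ∧ ⋯ ∧ s_a) ⊗ (s_j·w)`. -/
def IsKoszulMap (n d a b : ℕ)
    (δ : ((⋀[K]^a (S K n d)) ⊗[K] (S K n b)) →ₗ[K]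
         ((⋀[K]^(a - 1) (S K n d)) ⊗[K] (S K n (b + d)))) : Prop :=
  ∀ (s : Fin a → S K n d) (w : S K n b),
    δ (wedge K a s ⊗ₜ[K] w) =
      ∑ j : Fin a, ((-1 : K) ^ (j : ℕ)) •
        ((wedge K (a - 1) fun i => s (skipAt j i)) ⊗ₜ[K] mulSW K (s j) w)

/-- Exactness of the Veronese–Koszul complex at `(i, q)`:
`ker δ_{i,qd} = im δ_{i+1,(q−1)d}` inside `⋀^i S_d ⊗ S_{qd}`. -/
def VKExact (n d i q : ℕ) : Prop :=
  ∀ (h : (q - 1) * d + d = q * d)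
    (δ₁ : ((⋀[K]^i (S K n d)) ⊗[K] (S K n (q * d))) →ₗ[K]
          ((⋀[K]^(i - 1) (S K n d)) ⊗[K] (S K n (q * d + d))))
    (δ₂ : ((⋀[K]^(i + 1) (S K n d)) ⊗[K] (S K n ((q - 1) * d))) →ₗ[K]
          ((⋀[K]^i (S K n d)) ⊗[K] (S K n ((q - 1) * d + d)))),
    IsKoszulMap K n d i (q * d) δ₁ → IsKoszulMap K n d (i + 1) ((q - 1) * d) δ₂ →
    LinearMap.ker δ₁ =
      LinearMap.range
        ((TensorProduct.congr (LinearEquiv.refl K (⋀[K]^i (S K n d)))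
            (scast K h)).toLinearMap ∘ₗ δ₂)

end

set_option linter.unusedSectionVars false

namespace VK

section model

variable {K : Type*} [Field K] {σ : Type*} [Fintype σ] [DecidableEq σ]

/-- Multiplication by the monomial `x^β` on families indexed by monomials. -/
noncomputable def sh {E : Type*} [Zero E] (β : σ →₀ ℕ) (z : (σ →₀ ℕ) → E) : (σ →₀ ℕ) → E :=
  open Classical in fun m => if β ≤ m then z (m - β) else 0

lemma sh_sh {E : Type*} [Zero E] (β γ : σ →₀ ℕ) (z : (σ →₀ ℕ) → E) :
    sh β (sh γ z) = sh (β + γ) z := by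
  classical
  funext m
  unfold sh
  by_cases h1 : β ≤ m
  · have : γ ≤ m - β ↔ β + γ ≤ m := by
      rw [add_comm]; exact le_tsub_iff_right h1
    simp only [h1, if_true, this, tsub_tsub]
  · have : ¬ (β + γ ≤ m) := fun h => h1 (le_trans (le_self_add) h)
    simp [h1, this]

lemma sh_add {E : Type*} [AddCommGroup E] (β : σ →₀ ℕ) (z w : (σ →₀ ℕ) → E) :
    sh β (z + w) = sh β z + sh β w := by
  classical
  funext m
  by_cases h : β ≤ m <;> simp [sh, h]

lemma sh_sub {E : Type*} [AddCommGroup E] (β : σ →₀ ℕ) (z w : (σ →₀ ℕ) → E) :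
    sh β (z - w) = sh β z - sh β w := by
  classical
  funext m
  by_cases h : β ≤ m <;> simp [sh, h]

/-- Homogeneity of a family. -/
def IsDeg {E : Type*} [Zero E] (e : ℕ) (z : (σ →₀ ℕ) → E) : Prop :=
  ∀ m : σ →₀ ℕ, m.degree ≠ e → z m = 0

/-- Membership in the ideal generated by the `x_j^d`, `j ∈ T`. -/
def InJ {E : Type*} [Zero E] (d : ℕ) (T : Finset σ) (z : (σ →₀ ℕ) → E) : Prop :=
  ∀ m : σ →₀ ℕ, (∀ j ∈ T, m j < d) → z m = 0

lemma InJ.add {E : Type*} [AddCommGroup E] {d : ℕ} {T : Finset σ} {z w : (σ →₀ ℕ) → E}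
    (hz : InJ d T z) (hw : InJ d T w) : InJ d T (z + w) := by
  intro m hm
  simp [hz m hm, hw m hm]

lemma InJ.sub {E : Type*} [AddCommGroup E] {d : ℕ} {T : Finset σ} {z w : (σ →₀ ℕ) → E}
    (hz : InJ d T z) (hw : InJ d T w) : InJ d T (z - w) := by
  intro m hm
  simp [hz m hm, hw m hm]

lemma InJ.sh {E : Type*} [AddCommGroup E] {d : ℕ} {T : Finset σ} {z : (σ →₀ ℕ) → E}
    (hz : InJ d T z) (β : σ →₀ ℕ) : InJ d T (sh β z) := by
  classical
  intro m hm
  unfold VK.sh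
  split_ifs
  · exact hz _ fun j hj => lt_of_le_of_lt (by simp) (hm j hj)
  · rfl

lemma IsDeg.sub {E : Type*} [AddCommGroup E] {e : ℕ} {z w : (σ →₀ ℕ) → E}
    (hz : IsDeg e z) (hw : IsDeg e w) : IsDeg e (z - w) := by
  intro m hm
  simp [hz m hm, hw m hm]

lemma IsDeg.sh {E : Type*} [AddCommGroup E] {e : ℕ} {z : (σ →₀ ℕ) → E}
    (hz : IsDeg e z) (β : σ →₀ ℕ) : IsDeg (e + β.degree) (sh β z) := by
  classical
  intro m hm
  unfold VK.sh
  split_ifs with h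
  · apply hz
    intro h'
    apply hm
    rw [← h', ← map_add, tsub_add_cancel_of_le h]
  · rfl

variable {E : ℕ → Type*} [∀ i, AddCommGroup (E i)] [∀ i, Module K (E i)]
  (c : ∀ i, (σ →₀ ℕ) → E (i + 1) →ₗ[K] E i) (B : Finset (σ →₀ ℕ))

/-- The Koszul differential in the model. -/
noncomputable def del {i : ℕ} (z : (σ →₀ ℕ) → E (i + 1)) : (σ →₀ ℕ) → E i :=
  fun m => ∑ β ∈ B, c i β (sh β z m)

lemma del_sub {i : ℕ} (z w : (σ →₀ ℕ) → E (i + 1)) :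
    del c B (z - w) = del c B z - del c B w := by
  funext m
  simp [del, sh_sub, Finset.sum_sub_distrib]

lemma del_add {i : ℕ} (z w : (σ →₀ ℕ) → E (i + 1)) :
    del c B (z + w) = del c B z + del c B w := by
  funext m
  simp [del, sh_add, Finset.sum_add_distrib]

lemma sh_del {i : ℕ} (β : σ →₀ ℕ) (z : (σ →₀ ℕ) → E (i + 1)) :
    sh β (del c B z) = del c B (sh β z) := by
  classical
  funext m
  simp only [del, sh_sh]
  simp only [add_comm _ β]
  simp only [← sh_sh]
  by_cases h : β ≤ m <;> simp [sh, del, h]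

lemma InJ.del {i : ℕ} {d : ℕ} {T : Finset σ} {z : (σ →₀ ℕ) → E (i + 1)}
    (hz : InJ d T z) : InJ d T (del c B z) := by
  intro m hm
  apply Finset.sum_eq_zero
  intro β _
  rw [hz.sh β m hm, map_zero]

lemma IsDeg.del {i : ℕ} {d e : ℕ} (hB : ∀ β ∈ B, β.degree = d) {z : (σ →₀ ℕ) → E (i + 1)}
    (hz : IsDeg e z) : IsDeg (e + d) (del c B z) := by
  intro m hm
  apply Finset.sum_eq_zero
  intro β hβ
  rw [hz.sh β m (by rwa [hB β hβ]), map_zero]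

lemma del_del (hc : ∀ i β γ (x : E (i + 2)), c i β (c (i + 1) γ x) = - c i γ (c (i + 1) β x))
    (hcc : ∀ i β (x : E (i + 2)), c i β (c (i + 1) β x) = 0)
    {i : ℕ} (z : (σ →₀ ℕ) → E (i + 2)) : del c B (del c B z) = 0 := by
  classical
  funext m
  have key : del c B (del c B z) m
      = ∑ β ∈ B, ∑ γ ∈ B, c i β (c (i + 1) γ (sh (β + γ) z m)) := by
    simp only [del]
    apply Finset.sum_congr rfl
    intro β _
    rw [← map_sum]
    congr 1
    simp only [← sh_sh]
    by_cases h : β ≤ m <;> simp [sh, del, h]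
  rw [key, ← Finset.sum_product']
  apply Finset.sum_involution (fun (p : (σ →₀ ℕ) × (σ →₀ ℕ)) _ => (p.2, p.1))
  · rintro ⟨β, γ⟩ _
    simp only
    rw [hc i γ β, add_comm γ β, add_neg_cancel]
  · rintro ⟨β, γ⟩ _ h h'
    simp only [Prod.mk.injEq] at h'
    apply h
    simp only
    rw [h'.1]
    exact hcc _ _ _
  · rintro ⟨β, γ⟩ h
    simp only [Finset.mem_product] at h ⊢
    exact ⟨h.2, h.1⟩
  · rintro ⟨β, γ⟩ _
    rfl

/-- Division step: an element of `J_{insert k T}` is a multiple of `x_k^d` modulo `J_T`. -/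
lemma InJ.div {F : Type*} [AddCommGroup F] {d e : ℕ} {k : σ} {T : Finset σ}
    {z : (σ →₀ ℕ) → F} (hz : InJ d (insert k T) z) (hdeg : IsDeg (e + d) z) :
    ∃ y, IsDeg e y ∧ InJ d T (z - VK.sh (Finsupp.single k d) y) := by
  classical
  refine ⟨fun m => z (m + Finsupp.single k d), ?_, ?_⟩
  · intro m hm
    apply hdeg
    rw [map_add, Finsupp.degree_single]
    omega
  · intro m hm
    by_cases h : d ≤ m k
    · have h' : Finsupp.single k d ≤ m := by simpa using h
      simp [VK.sh, h', tsub_add_cancel_of_le h']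
    · have h' : ¬ Finsupp.single k d ≤ m := by simpa using h
      have : z m = 0 := hz m (by
        intro j hj
        rcases Finset.mem_insert.1 hj with rfl | hj
        · omega
        · exact hm j hj)
      simp [VK.sh, h', this]

lemma InJ.of_sh {F : Type*} [AddCommGroup F] {d : ℕ} {k : σ} {T : Finset σ} (hk : k ∉ T)
    {y : (σ →₀ ℕ) → F} (h : InJ d T (VK.sh (Finsupp.single k d) y)) : InJ d T y := by
  classical
  intro m hm
  have := h (m + Finsupp.single k d) (by
    intro j hj
    have : k ≠ j := by rintro rfl; exact hk hj
    simpa [Finsupp.single_apply, this] using hm j hj)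
  simpa [VK.sh] using this

lemma InJ.mono {F : Type*} [AddCommGroup F] {d : ℕ} {k : σ} {T : Finset σ}
    {y : (σ →₀ ℕ) → F} (h : InJ d T y) : InJ d (insert k T) y := by
  intro m hm
  exact h m fun j hj => hm j (Finset.mem_insert_of_mem hj)

lemma InJ.sh_self {F : Type*} [AddCommGroup F] {d : ℕ} {k : σ} {T : Finset σ}
    (y : (σ →₀ ℕ) → F) : InJ d (insert k T) (VK.sh (Finsupp.single k d) y) := by
  classical
  intro m hm
  have := hm k (Finset.mem_insert_self _ _)
  have h' : ¬ Finsupp.single k d ≤ m := by simpa using this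
  simp [VK.sh, h']

theorem reduce (hc : ∀ i β γ (x : E (i + 2)), c i β (c (i + 1) γ x) = - c i γ (c (i + 1) β x))
    (hcc : ∀ i β (x : E (i + 2)), c i β (c (i + 1) β x) = 0)
    {d : ℕ} (hB : ∀ β ∈ B, β.degree = d) (p : ℕ)
    (H0 : ∀ z : (σ →₀ ℕ) → E 0, IsDeg (d + d) z → ∃ v : (σ →₀ ℕ) → E 1,
      IsDeg d v ∧ del c B v = z)
    (H : ∀ i, i + 1 ≤ p → ∀ z : (σ →₀ ℕ) → E (i + 1), IsDeg (d + d) z → del c B z = 0 →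
      ∃ v : (σ →₀ ℕ) → E (i + 2), IsDeg d v ∧ del c B v = z) (T : Finset σ) :
    ∀ i, i + 1 ≤ p → ∀ z : (σ →₀ ℕ) → E (i + 1), IsDeg (d + d) z → InJ d T (del c B z) →
      ∃ v : (σ →₀ ℕ) → E (i + 2), IsDeg d v ∧ InJ d T (z - del c B v) := by
  induction T using Finset.induction_on with
  | empty =>
    intro i hi z hz hJ
    obtain ⟨v, hv, hvz⟩ := H i hi z hz (by funext m; exact hJ m (by simp))
    exact ⟨v, hv, by rw [hvz]; intro m _; simp⟩
  | insert k T hk ih =>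
    intro i hi z hz hJ
    obtain ⟨y, hy, hyz⟩ := hJ.div (e := d + d) (hz.del c B hB)
    have hu : ∃ u : (σ →₀ ℕ) → E (i + 1), IsDeg d u ∧ InJ d T (y - del c B u) := by
      cases i with
      | zero =>
        obtain ⟨u, hu, huy⟩ := H0 y hy
        exact ⟨u, hu, by rw [huy]; intro m _; simp⟩
      | succ i =>
        refine ih i (by omega) y hy ?_
        apply InJ.of_sh hk
        rw [sh_del]
        have h1 := hyz.del c B
        rw [del_sub, del_del c B hc hcc] at h1
        intro m hm
        simpa using h1 m hm
    obtain ⟨u, hu, huy⟩ := hu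
    have hs : IsDeg (d + d) (sh (Finsupp.single k d) u) := by
      have := hu.sh (Finsupp.single k d)
      rwa [Finsupp.degree_single] at this
    obtain ⟨v, hv, hvz⟩ := ih i hi (z - sh (Finsupp.single k d) u) (hz.sub hs) (by
      have h2 := hyz.add (huy.sh (Finsupp.single k d))
      rw [sh_sub, sh_del] at h2
      rw [del_sub]
      simpa using h2)
    refine ⟨v, hv, ?_⟩
    have h3 := (hvz.mono (k := k)).add (InJ.sh_self (d := d) (k := k) (T := T) u)
    convert h3 using 1
    abel

end model

end VK

namespace VK

section contraction

variable {K : Type*} [Field K] {V : Type*} [AddCommGroup V] [Module K V]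

/-- Contraction with a linear form, as an alternating map. -/
noncomputable def cAlt (l : V →ₗ[K] K) (a : ℕ) : V [⋀^Fin (a + 1)]→ₗ[K] (⋀[K]^a V) :=
  AlternatingMap.alternatizeUncurryFin (l.smulRight (exteriorPower.ιMulti K a))

/-- Contraction with a linear form. -/
noncomputable def ctr (l : V →ₗ[K] K) (a : ℕ) : (⋀[K]^(a + 1) V) →ₗ[K] (⋀[K]^a V) :=
  exteriorPower.alternatingMapLinearEquiv (cAlt l a)

lemma ctr_ιMulti (l : V →ₗ[K] K) (a : ℕ) (s : Fin (a + 1) → V) :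
    ctr l a (exteriorPower.ιMulti K (a + 1) s) =
      ∑ j : Fin (a + 1), ((-1 : K) ^ (j : ℕ)) • (l (s j) •
        exteriorPower.ιMulti K a (fun i => s (j.succAbove i))) := by
  rw [ctr, exteriorPower.alternatingMapLinearEquiv_apply_ιMulti, cAlt,
    AlternatingMap.alternatizeUncurryFin_apply]
  apply Finset.sum_congr rfl
  intro j _
  rcases Nat.even_or_odd (j : ℕ) with h | h <;> simp [h.neg_one_pow] <;> rfl

lemma ctr_ctr (l : V →ₗ[K] K) (a : ℕ) (x : ⋀[K]^(a + 2) V) : ctr l a (ctr l (a + 1) x) = 0 := by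
  have : (ctr l a) ∘ₗ (ctr l (a + 1)) = 0 := by
    apply exteriorPower.linearMap_ext
    have h := AlternatingMap.alternatizeUncurryFin_alternatizeUncurryFinLM_comp_of_symmetric
      (R := K) (M := V) (n := a)
      (f := l.smulRight (l.smulRight (exteriorPower.ιMulti K a (M := V)))) (by
        intro x y
        ext v
        simp [smul_smul, mul_comm])
    ext1 v
    have h' := DFunLike.congr_fun h v
    simp only [LinearMap.compAlternatingMap_apply, LinearMap.comp_apply]
    rw [ctr_ιMulti, map_sum]
    rw [AlternatingMap.alternatizeUncurryFin_apply] at h'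
    simp only [AlternatingMap.zero_apply, LinearMap.zero_apply] at h' ⊢
    rw [← h']
    apply Finset.sum_congr rfl
    intro j _
    rw [map_smul, map_smul, ctr, exteriorPower.alternatingMapLinearEquiv_apply_ιMulti, cAlt]
    rcases Nat.even_or_odd (j : ℕ) with h | h <;> simp [h.neg_one_pow] <;> rfl
  exact DFunLike.congr_fun this x

lemma ctr_add (l l' : V →ₗ[K] K) (a : ℕ) (x : ⋀[K]^(a + 1) V) :
    ctr (l + l') a x = ctr l a x + ctr l' a x := by
  have : ctr (l + l') a = ctr l a + ctr l' a := by
    apply exteriorPower.linearMap_ext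
    ext1 v
    simp only [LinearMap.compAlternatingMap_apply, LinearMap.add_apply]
    simp only [ctr_ιMulti, LinearMap.add_apply, add_smul, smul_add, Finset.sum_add_distrib]
  rw [this]; rfl

lemma ctr_comm (l l' : V →ₗ[K] K) (a : ℕ) (x : ⋀[K]^(a + 2) V) :
    ctr l a (ctr l' (a + 1) x) = - ctr l' a (ctr l (a + 1) x) := by
  have e : ctr (l + l') a (ctr (l + l') (a + 1) x) =
      ctr l a (ctr l' (a + 1) x) + ctr l' a (ctr l (a + 1) x) := by
    rw [ctr_add l l' a, ctr_add l l' (a + 1) x, map_add, map_add, ctr_ctr l, ctr_ctr l',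
      zero_add, add_zero]
  rw [ctr_ctr] at e
  exact eq_neg_of_add_eq_zero_left e.symm

/-- The determinant functional dual to a family of linear forms. -/
noncomputable def detF {p : ℕ} (l : Fin p → V →ₗ[K] K) : (⋀[K]^p V) →ₗ[K] K :=
  exteriorPower.alternatingMapLinearEquiv
    ((Matrix.detRowAlternating (n := Fin p) (R := K)).compLinearMap (LinearMap.pi l))

lemma detF_ιMulti {p : ℕ} (l : Fin p → V →ₗ[K] K) (s : Fin p → V) :
    detF l (exteriorPower.ιMulti K p s) = Matrix.det (Matrix.of fun i k => l k (s i)) := by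
  rw [detF, exteriorPower.alternatingMapLinearEquiv_apply_ιMulti]
  rfl

lemma detF_ctr {p : ℕ} (l : Fin p → V →ₗ[K] K) (k : Fin p) (x : ⋀[K]^(p + 1) V) :
    detF l (ctr (l k) p x) = 0 := by
  have : (detF l) ∘ₗ (ctr (l k) p) = 0 := by
    apply exteriorPower.linearMap_ext
    ext1 s
    simp only [LinearMap.compAlternatingMap_apply, LinearMap.comp_apply, LinearMap.zero_apply]
    rw [ctr_ιMulti, map_sum]
    simp only [map_smul, detF_ιMulti]
    let A : Matrix (Fin (p + 1)) (Fin (p + 1)) K :=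
      Matrix.of fun i => Fin.cons (l k (s i)) (fun q => l q (s i))
    have hA : A.det = 0 := by
      apply Matrix.det_zero_of_column_eq (i := 0) (j := k.succ) (Fin.succ_ne_zero k).symm
      intro i
      simp [A]
    rw [Matrix.det_succ_column_zero] at hA
    rw [← hA]
    apply Finset.sum_congr rfl
    intro j _
    simp only [smul_eq_mul, mul_assoc]
    rfl
  exact DFunLike.congr_fun this x

lemma ctr_zero_section (l : V →ₗ[K] K) (s : V) (x : ⋀[K]^0 V) :
    ctr l 0 (exteriorPower.zeroEquiv K V x • exteriorPower.ιMulti K 1 (fun _ => s)) = l s • x := by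
  apply (exteriorPower.zeroEquiv K V).injective
  rw [map_smul, ctr_ιMulti]
  simp [exteriorPower.zeroEquiv_ιMulti, mul_comm]

end contraction

end VK

namespace VK

section bridge

variable {K : Type*} [Field K] {n : ℕ}

/-- The exponents of degree `d`. -/
noncomputable def mons (n d : ℕ) : Finset (Fin (n + 1) →₀ ℕ) :=
  Finset.univ.finsuppAntidiag d

lemma mem_mons {n d : ℕ} {m : Fin (n + 1) →₀ ℕ} : m ∈ mons n d ↔ m.degree = d := by
  simp [mons, Finset.mem_finsuppAntidiag, Finsupp.degree_eq_sum]

/-- Coefficient functional. -/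
noncomputable def cf (K : Type*) [Field K] (n d : ℕ) (β : Fin (n + 1) →₀ ℕ) : S K n d →ₗ[K] K :=
  (MvPolynomial.lcoeff K β) ∘ₗ (S K n d).subtype

lemma cf_apply (d : ℕ) (β : Fin (n + 1) →₀ ℕ) (s : S K n d) :
    cf K n d β s = MvPolynomial.coeff β (s : MvPolynomial (Fin (n + 1)) K) := rfl

open Classical in
/-- Monomials. -/
noncomputable def mon (K : Type*) [Field K] (n d : ℕ) (β : Fin (n + 1) →₀ ℕ) : S K n d :=
  if h : β.degree = d then
    ⟨MvPolynomial.monomial β 1, (MvPolynomial.mem_homogeneousSubmodule _ _).2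
      (MvPolynomial.isHomogeneous_monomial 1 h)⟩
  else 0

lemma coe_mon {d : ℕ} {β : Fin (n + 1) →₀ ℕ} (h : β.degree = d) :
    (mon K n d β : MvPolynomial (Fin (n + 1)) K) = MvPolynomial.monomial β 1 := by
  simp [mon, h]

lemma cf_mon {d : ℕ} {β : Fin (n + 1) →₀ ℕ} (h : β.degree = d) (γ : Fin (n + 1) →₀ ℕ)
    [Decidable (β = γ)] :
    cf K n d γ (mon K n d β) = if β = γ then 1 else 0 := by
  classical
  rw [cf_apply, coe_mon h, MvPolynomial.coeff_monomial]
  congr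

lemma cf_of_ne {d : ℕ} {β : Fin (n + 1) →₀ ℕ} (h : β.degree ≠ d) (s : S K n d) :
    cf K n d β s = 0 := by
  rw [cf_apply]
  exact ((MvPolynomial.mem_homogeneousSubmodule _ _).1 s.2).coeff_eq_zero h

lemma sum_mon {d : ℕ} (s : S K n d) : ∑ β ∈ mons n d, cf K n d β s • mon K n d β = s := by
  classical
  apply Subtype.ext
  apply MvPolynomial.ext
  intro m
  rw [← cf_apply, ← cf_apply, map_sum]
  simp only [map_smul]
  by_cases hm : m.degree = d
  · rw [Finset.sum_eq_single m]
    · rw [cf_mon hm]; simp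
    · intro β hβ hne
      rw [cf_mon (mem_mons.1 hβ)]; simp [hne]
    · intro h; exact absurd (mem_mons.2 hm) h
  · rw [cf_of_ne hm]
    apply Finset.sum_eq_zero
    intro β hβ
    rw [cf_of_ne hm]; simp

/-- Multiplication by `s`. -/
noncomputable def mulL {d : ℕ} (b : ℕ) (s : S K n d) : S K n b →ₗ[K] S K n (b + d) where
  toFun w := mulSW K s w
  map_add' x y := by
    apply Subtype.ext
    simp [mulSW, mul_add]
  map_smul' r x := by
    apply Subtype.ext
    simp [mulSW]

/-- The Koszul differential. -/
noncomputable def kos (K : Type*) [Field K] (n d a b : ℕ) :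
    ((⋀[K]^(a + 1) (S K n d)) ⊗[K] (S K n b)) →ₗ[K]
         ((⋀[K]^a (S K n d)) ⊗[K] (S K n (b + d))) :=
  ∑ β ∈ mons n d, TensorProduct.map (ctr (cf K n d β) a) (mulL b (mon K n d β))

lemma kos_tmul (d a b : ℕ) (x : ⋀[K]^(a + 1) (S K n d)) (w : S K n b) :
    kos K n d a b (x ⊗ₜ w) =
      ∑ β ∈ mons n d, ctr (cf K n d β) a x ⊗ₜ[K] mulSW K (mon K n d β) w := by
  simp [kos, mulL]

lemma mulSW_sum {d b : ℕ} (s : S K n d) (w : S K n b) :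
    mulSW K s w = ∑ β ∈ mons n d, cf K n d β s • mulSW K (mon K n d β) w := by
  apply Subtype.ext
  have : (s : MvPolynomial (Fin (n + 1)) K) =
      ∑ β ∈ mons n d, cf K n d β s • (mon K n d β : MvPolynomial (Fin (n + 1)) K) := by
    conv_lhs => rw [← sum_mon s]
    simp
  simp only [mulSW, Submodule.coe_sum, Submodule.coe_smul]
  rw [this, Finset.sum_mul]
  simp

lemma skipAt_eq {a : ℕ} (j : Fin (a + 1)) (i : Fin a) : skipAt j i = j.succAbove i := by
  unfold skipAt Fin.succAbove
  by_cases h : (i : ℕ) < (j : ℕ)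
  · have : i.castSucc < j := by simpa [Fin.lt_def] using h
    simp only [h, if_true, this]
    rfl
  · have : ¬ i.castSucc < j := by simpa [Fin.lt_def] using h
    simp only [h, if_false, this]
    rfl

lemma isKoszulMap_kos (d a b : ℕ) : IsKoszulMap K n d (a + 1) b (kos K n d a b) := by
  intro s w
  have h1 : wedge K (a + 1) s = exteriorPower.ιMulti K (a + 1) s := rfl
  rw [h1, kos_tmul]
  simp only [ctr_ιMulti]
  simp only [TensorProduct.sum_tmul]
  rw [Finset.sum_comm]
  apply Finset.sum_congr rfl
  intro j _
  have h2 : (wedge K (a + 1 - 1) fun i => s (skipAt j i)) =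
      exteriorPower.ιMulti K a (fun i => s (j.succAbove i)) := by
    have : (fun i => s (skipAt j i)) = (fun i : Fin a => s (j.succAbove i)) := by
      funext i; rw [← skipAt_eq]
    have h3 : (wedge K (a + 1 - 1) fun i => s (skipAt j i)) =
      (exteriorPower.ιMulti K a fun i => s (skipAt j i)) := rfl
    rw [h3]
    exact congrArg _ this
  rw [h2, mulSW_sum, TensorProduct.tmul_sum, Finset.smul_sum]
  apply Finset.sum_congr rfl
  intro β _
  rw [TensorProduct.tmul_smul, TensorProduct.smul_tmul', TensorProduct.smul_tmul']

section Phi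

variable {M : Type*} [AddCommGroup M] [Module K M]

/-- The coefficient families of a tensor. -/
noncomputable def Phi (b : ℕ) (m : Fin (n + 1) →₀ ℕ) : M ⊗[K] (S K n b) →ₗ[K] M :=
  (TensorProduct.rid K M).toLinearMap ∘ₗ LinearMap.lTensor M (cf K n b m)

lemma Phi_tmul (b : ℕ) (m : Fin (n + 1) →₀ ℕ) (x : M) (w : S K n b) :
    Phi b m (x ⊗ₜ[K] w) = cf K n b m w • x := by
  simp [Phi]

/-- Reconstruct a tensor from its coefficients. -/
noncomputable def Psi (b : ℕ) (z : (Fin (n + 1) →₀ ℕ) → M) : M ⊗[K] (S K n b) :=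
  ∑ m ∈ mons n b, z m ⊗ₜ[K] mon K n b m

lemma Psi_Phi (b : ℕ) (x : M ⊗[K] (S K n b)) : Psi b (fun m => Phi b m x) = x := by
  induction x using TensorProduct.induction_on with
  | zero => simp [Psi]
  | tmul x w =>
    simp only [Psi, Phi_tmul]
    conv_rhs => rw [← sum_mon w, TensorProduct.tmul_sum]
    apply Finset.sum_congr rfl
    intro m _
    rw [TensorProduct.tmul_smul, TensorProduct.smul_tmul']
  | add x y hx hy =>
    conv_rhs => rw [← hx, ← hy]
    simp [Psi, TensorProduct.add_tmul, Finset.sum_add_distrib]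

lemma Phi_Psi (b : ℕ) (z : (Fin (n + 1) →₀ ℕ) → M) (hz : IsDeg b z) (m : Fin (n + 1) →₀ ℕ) :
    Phi b m (Psi b z : M ⊗[K] (S K n b)) = z m := by
  classical
  simp only [Psi, map_sum, Phi_tmul]
  by_cases hm : m.degree = b
  · rw [Finset.sum_eq_single m]
    · rw [cf_mon hm]; simp
    · intro β hβ hne
      rw [cf_mon (mem_mons.1 hβ)]; simp [hne]
    · intro h; exact absurd (mem_mons.2 hm) h
  · rw [hz m hm]
    apply Finset.sum_eq_zero
    intro β hβ
    rw [cf_of_ne hm]; simp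

lemma Phi_isDeg (b : ℕ) (x : M ⊗[K] (S K n b)) : IsDeg b (fun m => Phi b m x) := by
  intro m hm
  have : cf K n b m = 0 := by
    ext1 s
    exact cf_of_ne hm s
  simp [Phi, this]

lemma Phi_cast {b b' : ℕ} (h : b = b') (x : M ⊗[K] (S K n b)) (m : Fin (n + 1) →₀ ℕ) :
    Phi b' m (TensorProduct.congr (LinearEquiv.refl K M) (scast K h) x) = Phi b m x := by
  subst h
  induction x using TensorProduct.induction_on with
  | zero => simp
  | tmul x w =>
    rw [TensorProduct.congr_tmul, Phi_tmul, Phi_tmul]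
    rfl
  | add x y hx hy => rw [map_add, map_add, map_add, hx, hy]

end Phi

/-- The contraction operators indexed by exponents. -/
noncomputable def cc (K : Type*) [Field K] (n d : ℕ) (i : ℕ) (β : Fin (n + 1) →₀ ℕ) :
    (⋀[K]^(i + 1) (S K n d)) →ₗ[K] (⋀[K]^i (S K n d)) :=
  ctr (cf K n d β) i

lemma Phi_kos (d a b : ℕ) (x : (⋀[K]^(a + 1) (S K n d)) ⊗[K] (S K n b)) :
    (fun m => Phi (b + d) m (kos K n d a b x)) =
      del (E := fun i => ⋀[K]^i (S K n d)) (cc K n d) (mons n d) (fun m => Phi b m x) := by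
  classical
  funext m
  induction x using TensorProduct.induction_on with
  | zero => simp [del, sh]
  | tmul x w =>
    rw [kos_tmul]
    simp only [map_sum, Phi_tmul, del]
    apply Finset.sum_congr rfl
    intro β hβ
    rw [cf_apply, mulSW]
    simp only
    rw [coe_mon (mem_mons.1 hβ), MvPolynomial.coeff_monomial_mul']
    unfold sh
    split_ifs with h
    · rw [map_smul, one_mul]
      rfl
    · simp
  | add x y hx hy =>
    have e : (fun m => Phi b m (x + y)) = (fun m => Phi b m x) + (fun m => Phi b m y) := by
      funext m'
      exact map_add (Phi b m') x y
    have e1 : kos K n d a b (x + y) = kos K n d a b x + kos K n d a b y :=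
      map_add (kos K n d a b) x y
    have e2 := map_add (Phi (b + d) m) (kos K n d a b x) (kos K n d a b y)
    rw [e, e1]
    refine e2.trans ((congrArg₂ (· + ·) hx hy).trans ?_)
    exact (congrFun (del_add (E := fun i => ⋀[K]^i (S K n d)) (cc K n d) (mons n d)
      (fun m => Phi b m x) (fun m => Phi b m y)) m).symm

lemma exact_of_VKExact {d i : ℕ} (hE : VKExact K n d (i + 1) 2)
    (z : (Fin (n + 1) →₀ ℕ) → (⋀[K]^(i + 1) (S K n d))) (hz : IsDeg (d + d) z)
    (h0 : del (E := fun i => ⋀[K]^i (S K n d)) (cc K n d) (mons n d) z = 0) :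
    ∃ v : (Fin (n + 1) →₀ ℕ) → (⋀[K]^(i + 2) (S K n d)), IsDeg d v ∧
      del (E := fun i => ⋀[K]^i (S K n d)) (cc K n d) (mons n d) v = z := by
  have hd2 : d + d = 2 * d := by ring
  have hd1 : (2 - 1) * d = d := by simp
  have h : (2 - 1) * d + d = 2 * d := by omega
  have hE' := hE h (kos K n d i (2 * d)) (kos K n d (i + 1) ((2 - 1) * d))
    (isKoszulMap_kos _ _ _) (isKoszulMap_kos _ _ _)
  rw [hd2] at hz
  let x : (⋀[K]^(i + 1) (S K n d)) ⊗[K] (S K n (2 * d)) := Psi (2 * d) z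
  have hx : (fun m => Phi (2 * d) m x) = z := funext fun m => Phi_Psi _ z hz m
  have hk : kos K n d i (2 * d) x = 0 := by
    rw [← Psi_Phi _ (kos K n d i (2 * d) x), Phi_kos, hx, h0]
    simp [Psi]
  have hmem : x ∈ LinearMap.ker (kos K n d i (2 * d)) := hk
  rw [hE'] at hmem
  obtain ⟨y, hy⟩ := hmem
  refine ⟨fun m => Phi ((2 - 1) * d) m y, ?_, ?_⟩
  · intro m hm
    exact Phi_isDeg ((2 - 1) * d) y m (by rwa [hd1])
  · rw [← Phi_kos, ← hx]
    funext m
    rw [← hy]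
    exact (Phi_cast h _ m).symm

lemma surj_zero {d : ℕ}
    (z : (Fin (n + 1) →₀ ℕ) → (⋀[K]^0 (S K n d))) (hz : IsDeg (d + d) z) :
    ∃ v : (Fin (n + 1) →₀ ℕ) → (⋀[K]^1 (S K n d)), IsDeg d v ∧
      del (E := fun i => ⋀[K]^i (S K n d)) (cc K n d) (mons n d) v = z := by
  classical
  have hch : ∀ m : Fin (n + 1) →₀ ℕ, ∃ β : Fin (n + 1) →₀ ℕ,
      m.degree = d + d → β.degree = d ∧ β ≤ m := by
    intro m
    by_cases hm : m.degree = d + d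
    · obtain ⟨β, hβ⟩ := Finsupp.exists_le_degree_eq m d (by omega)
      exact ⟨β, fun _ => ⟨hβ.2, hβ.1⟩⟩
    · exact ⟨0, fun h => absurd h hm⟩
  choose ch hch using hch
  refine ⟨fun m => ∑ β ∈ mons n d, if ch (m + β) = β then
    exteriorPower.zeroEquiv K _ (z (m + β)) • exteriorPower.ιMulti K 1 (fun _ => mon K n d β)
    else 0, ?_, ?_⟩
  · intro m hm
    apply Finset.sum_eq_zero
    intro β hβ
    rw [hz (m + β) (by rw [map_add, mem_mons.1 hβ]; omega)]
    simp
  · funext m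
    have key : ∀ γ ∈ mons n d, ∀ m', cc K n d 0 γ (∑ β ∈ mons n d, if ch (m' + β) = β then
        exteriorPower.zeroEquiv K _ (z (m' + β)) • exteriorPower.ιMulti K 1 (fun _ => mon K n d β)
        else 0) = if ch (m' + γ) = γ then z (m' + γ) else 0 := by
      intro γ hγ m'
      rw [map_sum, Finset.sum_eq_single γ]
      · split_ifs
        · rw [cc, ctr_zero_section, cf_mon (mem_mons.1 hγ)]; simp
        · simp
      · intro β hβ hne
        split_ifs
        · rw [cc, ctr_zero_section, cf_mon (mem_mons.1 hβ)]; simp [hne]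
        · simp
      · intro h; exact absurd hγ h
    have : ∀ γ ∈ mons n d, cc K n d 0 γ (sh γ (fun m => ∑ β ∈ mons n d, if ch (m + β) = β then
        exteriorPower.zeroEquiv K _ (z (m + β)) • exteriorPower.ιMulti K 1 (fun _ => mon K n d β)
        else 0) m) = if γ ≤ m ∧ ch m = γ then z m else 0 := by
      intro γ hγ
      unfold sh
      by_cases hle : γ ≤ m
      · simp only [hle, if_true, true_and]
        rw [key γ hγ, tsub_add_cancel_of_le hle]
      · simp only [hle, if_false, false_and, map_zero]
    simp only [del]
    rw [Finset.sum_congr rfl this]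
    by_cases hm : m.degree = d + d
    · obtain ⟨h1, h2⟩ := hch m hm
      rw [Finset.sum_eq_single (ch m)]
      · simp [h2]
      · intro β _ hne
        simp [hne.symm]
      · intro h; exact absurd (mem_mons.2 h1) h
    · rw [hz m hm]; simp

end bridge

end VK

namespace VK

section final

variable {K : Type*} [Field K] {n : ℕ}

/-- The monomial `x_0^{d-1} x_1^{d-1} x_2^2`. -/
noncomputable def ff (n d : ℕ) (hn : 2 ≤ n) : Fin (n + 1) →₀ ℕ :=
  Finsupp.single ⟨0, by omega⟩ (d - 1) + Finsupp.single ⟨1, by omega⟩ (d - 1) +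
    Finsupp.single ⟨2, by omega⟩ 2

/-- The first three variables. -/
def TT (n : ℕ) (hn : 2 ≤ n) : Finset (Fin (n + 1)) :=
  {⟨0, by omega⟩, ⟨1, by omega⟩, ⟨2, by omega⟩}

lemma degree_ff {d : ℕ} (hn : 2 ≤ n) (hd : 3 ≤ d) : (ff n d hn).degree = d + d := by
  simp only [ff, map_add, Finsupp.degree_single]
  omega

lemma ff_zero {d : ℕ} (hn : 2 ≤ n) : ff n d hn ⟨0, by omega⟩ = d - 1 := by
  simp [ff]

lemma ff_one {d : ℕ} (hn : 2 ≤ n) : ff n d hn ⟨1, by omega⟩ = d - 1 := by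
  simp [ff]

lemma ff_two {d : ℕ} (hn : 2 ≤ n) : ff n d hn ⟨2, by omega⟩ = 2 := by
  simp [ff]

lemma ff_of_notMem {d : ℕ} (hn : 2 ≤ n) {j : Fin (n + 1)} (hj : j ∉ TT n hn) :
    ff n d hn j = 0 := by
  simp only [TT, Finset.mem_insert, Finset.mem_singleton, not_or] at hj
  obtain ⟨h0, h1, h2⟩ := hj
  rw [ff, Finsupp.add_apply, Finsupp.add_apply, Finsupp.single_eq_of_ne h0,
    Finsupp.single_eq_of_ne h1, Finsupp.single_eq_of_ne h2, add_zero, add_zero]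

lemma degree_of_TT (hn : 2 ≤ n) (m : Fin (n + 1) →₀ ℕ) (hm : ∀ j, j ∉ TT n hn → m j = 0) :
    m.degree = m ⟨0, by omega⟩ + m ⟨1, by omega⟩ + m ⟨2, by omega⟩ := by
  rw [Finsupp.degree_eq_sum, ← Finset.sum_subset (Finset.subset_univ (TT n hn))
    (fun j _ hj => hm j hj), TT, Finset.sum_insert, Finset.sum_insert, Finset.sum_singleton]
  · ring
  · simp
  · simp

lemma forall_TT (hn : 2 ≤ n) {P : Fin (n + 1) → Prop} :
    (∀ j ∈ TT n hn, P j) ↔ P ⟨0, by omega⟩ ∧ P ⟨1, by omega⟩ ∧ P ⟨2, by omega⟩ := by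
  simp [TT]

open Classical in
/-- The degree `d` monomials dividing `ff`. -/
noncomputable def MM (n d : ℕ) (hn : 2 ≤ n) : Finset (Fin (n + 1) →₀ ℕ) :=
  (mons n d).filter (· ≤ ff n d hn)

lemma mem_MM {d : ℕ} (hn : 2 ≤ n) {β : Fin (n + 1) →₀ ℕ} :
    β ∈ MM n d hn ↔ β.degree = d ∧ β ≤ ff n d hn := by
  simp [MM, mem_mons]

lemma MM_zero {d : ℕ} (hn : 2 ≤ n) {β : Fin (n + 1) →₀ ℕ} (h : β ∈ MM n d hn) :
    ∀ j, j ∉ TT n hn → β j = 0 := by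
  intro j hj
  have := ((mem_MM hn).1 h).2 j
  rw [ff_of_notMem hn hj] at this
  omega

lemma MM_spec {d : ℕ} (hn : 2 ≤ n) {β : Fin (n + 1) →₀ ℕ} (h : β ∈ MM n d hn) :
    β ⟨0, by omega⟩ + β ⟨1, by omega⟩ + β ⟨2, by omega⟩ = d ∧ β ⟨0, by omega⟩ ≤ d - 1 ∧
      β ⟨1, by omega⟩ ≤ d - 1 ∧ β ⟨2, by omega⟩ ≤ 2 := by
  have h1 := degree_of_TT hn β (MM_zero hn h)
  obtain ⟨h2, h3⟩ := (mem_MM hn).1 h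
  refine ⟨by omega, ?_, ?_, ?_⟩
  · exact (h3 _).trans (ff_zero (d := d) hn).le
  · exact (h3 _).trans (ff_one (d := d) hn).le
  · exact (h3 _).trans (ff_two (d := d) hn).le

lemma card_MM_pos {d : ℕ} (hn : 2 ≤ n) (hd : 3 ≤ d) : 1 ≤ (MM n d hn).card := by
  rw [Nat.one_le_iff_ne_zero, ← Nat.pos_iff_ne_zero, Finset.card_pos]
  obtain ⟨β, h1, h2⟩ := Finsupp.exists_le_degree_eq (ff n d hn) d (by
    rw [degree_ff hn hd]; omega)
  exact ⟨β, (mem_MM hn).2 ⟨h2, h1⟩⟩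

lemma card_MM_le {d : ℕ} (hn : 2 ≤ n) (hd : 3 ≤ d) : (MM n d hn).card ≤ 3 * d - 2 := by
  have hc : (((Finset.range d ×ˢ Finset.range 3).erase (0, 0)).erase (d - 1, 2)).card
      = 3 * d - 2 := by
    rw [Finset.card_erase_of_mem, Finset.card_erase_of_mem, Finset.card_product,
      Finset.card_range, Finset.card_range]
    · omega
    · simp; omega
    · simp; omega
  rw [← hc]
  apply Finset.card_le_card_of_injOn (fun β => (β ⟨0, by omega⟩, β ⟨2, by omega⟩))
  · intro β hβ
    obtain ⟨h1, h2, h3, h4⟩ := MM_spec hn (Finset.mem_coe.1 hβ)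
    simp only [Finset.coe_erase, Finset.coe_product, Finset.coe_range, Set.mem_sdiff,
      Set.mem_prod, Set.mem_Iio, Set.mem_singleton_iff, Prod.mk.injEq]
    omega
  · intro β hβ γ hγ h
    obtain ⟨h1, h2, h3, h4⟩ := MM_spec hn (Finset.mem_coe.1 hβ)
    obtain ⟨g1, g2, g3, g4⟩ := MM_spec hn (Finset.mem_coe.1 hγ)
    simp only [Prod.mk.injEq] at h
    ext j
    by_cases hj : j ∈ TT n hn
    · revert j
      rw [forall_TT]
      omega
    · rw [MM_zero hn (Finset.mem_coe.1 hβ) j hj, MM_zero hn (Finset.mem_coe.1 hγ) j hj]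

theorem not_all_exact (d : ℕ) (hn : 2 ≤ n) (hd : 3 ≤ d)
    (H : ∀ i, 1 ≤ i → i ≤ 3 * d - 2 → VKExact K n d i 2) : False := by
  classical
  obtain ⟨p, hp⟩ : ∃ p, (MM n d hn).card = p + 1 := by
    have := card_MM_pos hn hd
    exact ⟨(MM n d hn).card - 1, by omega⟩
  have hple := card_MM_le hn hd
  let e := ((MM n d hn).equivFinOfCardEq hp).symm
  let β : Fin (p + 1) → (Fin (n + 1) →₀ ℕ) := fun k => (e k).1
  have hβM : ∀ k, β k ∈ MM n d hn := fun k => (e k).2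
  have hβinj : ∀ k k', β k = β k' → k = k' := fun k k' h => e.injective (Subtype.ext h)
  have hβsurj : ∀ γ ∈ MM n d hn, ∃ k, β k = γ := fun γ hγ =>
    ⟨e.symm ⟨γ, hγ⟩, by simp [β]⟩
  have hβdeg : ∀ k, (β k).degree = d := fun k => ((mem_MM hn).1 (hβM k)).1
  let ω : ⋀[K]^(p + 1) (S K n d) :=
    exteriorPower.ιMulti K (p + 1) (fun k => mon K n d (β k))
  let z : (Fin (n + 1) →₀ ℕ) → (⋀[K]^(p + 1) (S K n d)) := fun m => if m = ff n d hn then ω else 0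
  have hz : IsDeg (d + d) z := by
    intro m hm
    have : m ≠ ff n d hn := by rintro rfl; exact hm (degree_ff hn hd)
    simp [z, this]
  have hJ : InJ d (TT n hn)
      (del (E := fun i => ⋀[K]^i (S K n d)) (cc K n d) (mons n d) z) := by
    intro m hm
    apply Finset.sum_eq_zero
    intro γ hγ
    by_cases hle : γ ≤ m ∧ m - γ = ff n d hn
    · obtain ⟨h1, h2⟩ := hle
      have hs : sh γ z m = ω := by
        unfold sh
        rw [if_pos h1]
        simp [z, h2]
      rw [hs]
      have hγM : γ ∉ MM n d hn := by
        intro hγM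
        have hmeq : m = ff n d hn + γ := by rw [← h2, tsub_add_cancel_of_le h1]
        have hdm : m.degree = d + d + d := by
          rw [hmeq, map_add, degree_ff hn hd, mem_mons.1 hγ]
        have := degree_of_TT hn m (by
          intro j hj
          rw [hmeq, Finsupp.add_apply, MM_zero hn hγM j hj, ff_of_notMem hn hj])
        rw [forall_TT] at hm
        omega
      rw [cc, ctr_ιMulti]
      apply Finset.sum_eq_zero
      intro j _
      have : β j ≠ γ := by rintro rfl; exact hγM (hβM j)
      rw [cf_mon (hβdeg j), if_neg this, zero_smul, smul_zero]
    · have hs : sh γ z m = 0 := by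
        unfold sh
        split_ifs with h1
        · have : m - γ ≠ ff n d hn := fun h => hle ⟨h1, h⟩
          simp [z, this]
        · rfl
      rw [hs, map_zero]
  obtain ⟨v, -, hv⟩ := reduce (E := fun i => ⋀[K]^i (S K n d)) (cc K n d) (mons n d)
    (fun i β γ x => ctr_comm _ _ i x) (fun i β x => ctr_ctr _ i x)
    (fun β hβ => mem_mons.1 hβ) (p + 1) (fun z hz => surj_zero z hz)
    (fun i hi z hz h0 => exact_of_VKExact (H (i + 1) (by omega) (by omega)) z hz h0)
    (TT n hn) p le_rfl z hz hJ
  have hvf := hv (ff n d hn) (by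
    rw [forall_TT, ff_zero, ff_one, ff_two]
    omega)
  have hω : ω = ∑ γ ∈ mons n d, cc K n d (p + 1) γ (sh γ v (ff n d hn)) := by
    have h1 : z (ff n d hn) = ω := by simp [z]
    rw [← h1]
    exact sub_eq_zero.1 hvf
  have hdet := congrArg (detF (fun k => cf K n d (β k))) hω
  rw [map_sum, Finset.sum_eq_zero] at hdet
  · rw [detF_ιMulti] at hdet
    have h1 : (Matrix.of fun i k => cf K n d (β k) (mon K n d (β i))) =
        (1 : Matrix (Fin (p + 1)) (Fin (p + 1)) K) := by
      ext i k
      rw [Matrix.of_apply, cf_mon (hβdeg i), Matrix.one_apply]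
      by_cases hik : i = k
      · simp [hik]
      · have : β i ≠ β k := fun h => hik (hβinj _ _ h)
        simp [hik, this]
    rw [h1, Matrix.det_one] at hdet
    exact one_ne_zero hdet
  · intro γ hγ
    by_cases hle : γ ≤ ff n d hn
    · obtain ⟨k, rfl⟩ := hβsurj γ ((mem_MM hn).2 ⟨mem_mons.1 hγ, hle⟩)
      exact detF_ctr (fun k => cf K n d (β k)) k _
    · have hs : sh γ v (ff n d hn) = 0 := by
        unfold sh
        rw [if_neg hle]
      rw [hs, map_zero, map_zero]

end final

end VK

/-- for `n ≥ 2`, `d ≥ 3`, there are `1 ≤ i ≤ 3d−2` and `q ≥ 2` such that the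
Veronese–Koszul complex at `(i,q)` is not exact (failure of property `N_{3d−2}`). -/
theorem stmt6 (K : Type*) [Field K] [CharZero K] (n d : ℕ) (hn : 2 ≤ n) (hd : 3 ≤ d) :
    ∃ i, 1 ≤ i ∧ i ≤ 3 * d - 2 ∧ ∃ q, 2 ≤ q ∧ ¬ VKExact K n d i q := by
  by_contra hcon
  push Not at hcon
  exact VK.not_all_exact (K := K) d hn hd (fun i h1 h2 => hcon i h1 h2 2 le_rfl)
end

section
/- Suppose n = 2 and d = 2. Then for all integers i ≥ 1 and q ≥ 2, the Veronese–Koszul complex at (i,q) is exact. (Equivalently, the Veronese surface φ_{O(2)}(P^2) ⊂ P^5 satisfies property N_p for every p ≥ 0.) -/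
open TensorProduct

open TensorProduct MvPolynomial

section GenericKoszul
variable {K : Type*} [Field K]
variable {V A B C : Type*} [AddCommGroup V] [Module K V] [AddCommGroup A] [Module K A]
  [AddCommGroup B] [Module K B] [AddCommGroup C] [Module K C]

/-- Left wedge with a fixed vector. -/
noncomputable def wedL (i : ℕ) (u : V) : ⋀[K]^i V →ₗ[K] ⋀[K]^(i + 1) V :=
  exteriorPower.alternatingMapLinearEquiv ((exteriorPower.ιMulti K (i + 1)).curryLeft u)

lemma wedL_apply (i : ℕ) (u : V) (v : Fin i → V) :
    wedL i u (exteriorPower.ιMulti K i v) =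
      exteriorPower.ιMulti K (i + 1) (Matrix.vecCons u v) := by
  rw [wedL, exteriorPower.alternatingMapLinearEquiv_apply_ιMulti]; rfl

/-- The homotopy. -/
noncomputable def hL (i : ℕ) (u : Fin 3 → V) (t : Fin 3 → B →ₗ[K] A) :
    (⋀[K]^i V) ⊗[K] B →ₗ[K] (⋀[K]^(i + 1) V) ⊗[K] A :=
  ∑ k : Fin 3, TensorProduct.map (wedL i (u k)) (t k)

lemma hL_apply (i : ℕ) (u : Fin 3 → V) (t : Fin 3 → B →ₗ[K] A) (v : Fin i → V) (w : B) :
    hL i u t (exteriorPower.ιMulti K i v ⊗ₜ[K] w) =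
      ∑ k : Fin 3, exteriorPower.ιMulti K (i + 1) (Matrix.vecCons (u k) v) ⊗ₜ[K] t k w := by
  simp only [hL, LinearMap.sum_apply, TensorProduct.map_tmul, wedL_apply]

/-- Koszul formula. -/
def IsK {a : ℕ} (m : V →ₗ[K] A →ₗ[K] B)
    (δ : (⋀[K]^(a + 1) V) ⊗[K] A →ₗ[K] (⋀[K]^a V) ⊗[K] B) : Prop :=
  ∀ (v : Fin (a + 1) → V) (w : A),
    δ (exteriorPower.ιMulti K (a + 1) v ⊗ₜ[K] w) =
      ∑ j : Fin (a + 1), ((-1 : ℤ) ^ (j : ℕ)) •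
        (exteriorPower.ιMulti K a (j.removeNth v) ⊗ₜ[K] m (v j) w)

lemma cancel_mem {Y : Type*} [AddCommMonoid Y] [Module K Y] (p : Submodule K Y) {c : K} {G y : Y}
    (hc : c ≠ 0) (hy : y ∈ p) (h : c • G + y ∈ p) : G ∈ p := by
  have h1 : y + (-1 : K) • y = 0 := by
    have : (1 : K) • y + (-1 : K) • y = 0 := by rw [← add_smul]; simp
    simpa only [one_smul] using this
  have h2 := p.smul_mem c⁻¹ (p.add_mem h (p.smul_mem (-1 : K) hy))
  rwa [add_assoc, h1, add_zero, smul_smul, inv_mul_cancel₀ hc, one_smul] at h2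

lemma ext_tens {a : ℕ} {Y : Type*} [AddCommMonoid Y] [Module K Y]
    {f g : (⋀[K]^a V) ⊗[K] A →ₗ[K] Y}
    (H : ∀ v w, f (exteriorPower.ιMulti K a v ⊗ₜ[K] w) = g (exteriorPower.ιMulti K a v ⊗ₜ[K] w)) :
    f = g := by
  refine TensorProduct.ext' fun x w => ?_
  have hx : x ∈ Submodule.span K (Set.range (exteriorPower.ιMulti K a (M := V))) := by
    rw [exteriorPower.ιMulti_span]; trivial
  induction hx using Submodule.span_induction with
  | mem x hx => obtain ⟨v, rfl⟩ := hx; exact H v w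
  | zero => simp
  | add x y _ _ hx hy => rw [TensorProduct.add_tmul, map_add, map_add, hx, hy]
  | smul r x _ hx => rw [← TensorProduct.smul_tmul', map_smul, map_smul, hx]

lemma dd_zero {a : ℕ} {m₁ : V →ₗ[K] A →ₗ[K] B} {m₂ : V →ₗ[K] B →ₗ[K] C}
    (hm : ∀ s t w, m₂ t (m₁ s w) = m₂ s (m₁ t w))
    {δ₁ : (⋀[K]^(a + 1) V) ⊗[K] B →ₗ[K] (⋀[K]^a V) ⊗[K] C}
    {δ₂ : (⋀[K]^(a + 2) V) ⊗[K] A →ₗ[K] (⋀[K]^(a + 1) V) ⊗[K] B}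
    (H₁ : IsK m₂ δ₁) (H₂ : IsK m₁ δ₂) : δ₁ ∘ₗ δ₂ = 0 := by
  refine ext_tens fun v w => ?_
  let F : V →ₗ[K] V →ₗ[K] V [⋀^Fin a]→ₗ[K] ((⋀[K]^a V) ⊗[K] C) :=
    LinearMap.mk₂ K (fun s t => ((TensorProduct.mk K (⋀[K]^a V) C).flip
        (m₂ t (m₁ s w))).compAlternatingMap (exteriorPower.ιMulti K a))
      (by intros; ext; simp)
      (by intros; ext; simp)
      (by intros; ext; simp)
      (by intros; ext; simp)
  have hF : ∀ s t, F s t = F t s := by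
    intro s t
    simp only [F, LinearMap.mk₂_apply, hm s t]
  have key := congrArg (fun g => g v)
    (AlternatingMap.alternatizeUncurryFin_alternatizeUncurryFinLM_comp_of_symmetric
      (R := K) (M := V) (N := (⋀[K]^a V) ⊗[K] C) (f := F) hF)
  simp only [AlternatingMap.alternatizeUncurryFin_apply, LinearMap.comp_apply,
    AlternatingMap.alternatizeUncurryFinLM_apply] at key
  rw [LinearMap.comp_apply, H₂, map_sum]
  simp only [map_zsmul]
  rw [Finset.sum_congr rfl fun j _ => by rw [H₁]]
  exact key

/-- The key formula for the homotopy. -/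
lemma P_formula {a : ℕ} {m₁ : V →ₗ[K] A →ₗ[K] B} {m₂ : V →ₗ[K] B →ₗ[K] C}
    (u : Fin 3 → V) (t₁ : Fin 3 → B →ₗ[K] A) (t₂ : Fin 3 → C →ₗ[K] B)
    {δ₁ : (⋀[K]^(a + 1) V) ⊗[K] B →ₗ[K] (⋀[K]^a V) ⊗[K] C}
    {δ₂ : (⋀[K]^(a + 2) V) ⊗[K] A →ₗ[K] (⋀[K]^(a + 1) V) ⊗[K] B}
    (H₁ : IsK m₂ δ₁) (H₂ : IsK m₁ δ₂) (v : Fin (a + 1) → V) (w : B) :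
    (δ₂ ∘ₗ hL (a + 1) u t₁ + hL a u t₂ ∘ₗ δ₁) (exteriorPower.ιMulti K (a + 1) v ⊗ₜ[K] w) =
      ∑ k : Fin 3, exteriorPower.ιMulti K (a + 1) v ⊗ₜ[K] m₁ (u k) (t₁ k w) +
      ∑ k : Fin 3, ∑ j : Fin (a + 1),
        exteriorPower.ιMulti K (a + 1) (Function.update v j (u k)) ⊗ₜ[K]
          (t₂ k (m₂ (v j) w) - m₁ (v j) (t₁ k w)) := by
  have hup : ∀ (j : Fin (a + 1)) (u : V),
      exteriorPower.ιMulti K (a + 1) (Function.update v j u) =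
        (-1 : ℤ) ^ (j : ℕ) • exteriorPower.ιMulti K (a + 1) (Matrix.vecCons u (j.removeNth v)) := by
    intro j u
    rw [← Fin.insertNth_removeNth, AlternatingMap.map_insertNth]
  rw [LinearMap.add_apply, LinearMap.comp_apply, LinearMap.comp_apply, H₁]
  simp only [hL_apply, map_sum, map_zsmul]
  rw [Finset.sum_congr rfl fun k _ => by rw [H₂, Fin.sum_univ_succ]]
  simp only [Finset.sum_add_distrib, Finset.smul_sum]
  rw [add_assoc]
  congr 1
  · refine Finset.sum_congr rfl fun k _ => ?_
    simp only [Fin.val_zero, pow_zero, one_smul, Matrix.cons_val_zero]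
    congr 1
  · rw [Finset.sum_comm (s := (Finset.univ : Finset (Fin (a + 1)))), ← Finset.sum_add_distrib]
    refine Finset.sum_congr rfl fun k _ => ?_
    rw [← Finset.sum_add_distrib]
    refine Finset.sum_congr rfl fun j _ => ?_
    have : (Fin.succ j).removeNth (Matrix.vecCons (u k) v) =
        Matrix.vecCons (u k) (j.removeNth v) := by
      ext l : 1
      refine Fin.cases ?_ (fun l => ?_) l
      · simp [Fin.removeNth]
      · simp [Fin.removeNth]
    rw [this, hup]
    simp only [TensorProduct.tmul_sub, Fin.val_succ,
      pow_succ, Matrix.cons_val_succ, TensorProduct.smul_tmul']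
    simp only [mul_neg, mul_one, neg_smul, TensorProduct.neg_tmul]
    abel

lemma mem_of_mon {a : ℕ} {ι : Type*} {mb : ι → B} (hmb : Submodule.span K (Set.range mb) = ⊤)
    (Q : Submodule K ((⋀[K]^a V) ⊗[K] B)) (v : Fin a → V)
    (H : ∀ p, exteriorPower.ιMulti K a v ⊗ₜ[K] mb p ∈ Q) (w : B) :
    exteriorPower.ιMulti K a v ⊗ₜ[K] w ∈ Q := by
  have hw : w ∈ Submodule.span K (Set.range mb) := by
    rw [hmb]; trivial
  induction hw using Submodule.span_induction with
  | mem x hx => obtain ⟨p, rfl⟩ := hx; exact H p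
  | zero => simp
  | add x y _ _ hx hy => rw [TensorProduct.tmul_add]; exact Q.add_mem hx hy
  | smul r x _ hx => rw [TensorProduct.tmul_smul]; exact Q.smul_mem _ hx

open Classical in
lemma P_surj [CharZero K] {a : ℕ} {m₁ : V →ₗ[K] A →ₗ[K] B} {m₂ : V →ₗ[K] B →ₗ[K] C}
    (t₁ : Fin 3 → B →ₗ[K] A) (t₂ : Fin 3 → C →ₗ[K] B)
    {M I : Type*} (mv : M → V) (mb : I → B) (sq : Fin 3 → M)
    (hmv : Submodule.span K (Set.range mv) = ⊤) (hmb : Submodule.span K (Set.range mb) = ⊤)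
    (N : Fin 3 → I → ℕ) (hE : ∀ k p, m₁ (mv (sq k)) (t₁ k (mb p)) = (N k p : K) • mb p)
    (hpos : ∀ p, 1 ≤ ∑ k : Fin 3, N k p)
    (hcom : ∀ k l p, t₂ k (m₂ (mv (sq l)) (mb p)) - m₁ (mv (sq l)) (t₁ k (mb p)) =
      if k = l then mb p else 0)
    {δ₁ : (⋀[K]^(a + 1) V) ⊗[K] B →ₗ[K] (⋀[K]^a V) ⊗[K] C}
    {δ₂ : (⋀[K]^(a + 2) V) ⊗[K] A →ₗ[K] (⋀[K]^(a + 1) V) ⊗[K] B}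
    (H₁ : IsK m₂ δ₁) (H₂ : IsK m₁ δ₂) :
    LinearMap.range (δ₂ ∘ₗ hL (a + 1) (fun k => mv (sq k)) t₁ +
      hL a (fun k => mv (sq k)) t₂ ∘ₗ δ₁) = ⊤ := by
  set P := δ₂ ∘ₗ hL (a + 1) (fun k => mv (sq k)) t₁ + hL a (fun k => mv (sq k)) t₂ ∘ₗ δ₁ with hP
  have main : ∀ (n : ℕ) (m : Fin (a + 1) → M),
      (Finset.univ.filter fun j => ¬ ∃ k, m j = sq k).card = n → ∀ w : B,
      exteriorPower.ιMulti K (a + 1) (fun j => mv (m j)) ⊗ₜ[K] w ∈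
        LinearMap.range P := by
    intro n
    induction n using Nat.strong_induction_on with
    | _ n ih =>
    intro m hm
    refine mem_of_mon hmb _ _ fun p => ?_
    set G := exteriorPower.ιMulti K (a + 1) (fun j => mv (m j)) ⊗ₜ[K] mb p
      with hG
    have hPG := P_formula (fun k => mv (sq k)) t₁ t₂ H₁ H₂ (fun j => mv (m j)) (mb p)
    rw [← hP, ← hG] at hPG
    -- the individual correction terms
    have hcorr : ∀ j : Fin (a + 1), ∃ r : ℕ, ∃ y ∈ LinearMap.range P, ∑ k : Fin 3,
        exteriorPower.ιMulti K (a + 1)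
          (Function.update (fun j => mv (m j)) j (mv (sq k))) ⊗ₜ[K]
          (t₂ k (m₂ (mv (m j)) (mb p)) - m₁ (mv (m j)) (t₁ k (mb p))) = (r : K) • G + y := by
      intro j
      by_cases hj : ∃ l, m j = sq l
      · obtain ⟨l, hl⟩ := hj
        refine ⟨1, 0, Submodule.zero_mem _, ?_⟩
        rw [Finset.sum_eq_single l]
        · rw [hl, hcom, if_pos rfl, ← hl]
          have : Function.update (fun j => mv (m j)) j (mv (m j)) =
              fun j => mv (m j) := Function.update_eq_self _ _
          rw [this, ← hG]
          simp
        · intro k _ hk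
          rw [hl, hcom, if_neg hk, TensorProduct.tmul_zero]
        · simp
      · refine ⟨0, _, ?_, by rw [Nat.cast_zero, zero_smul, zero_add]⟩
        refine Submodule.sum_mem _ fun k _ => ?_
        have : Function.update (fun j => mv (m j)) j (mv (sq k)) =
            fun i => mv (Function.update m j (sq k) i) := by
          ext i : 1
          by_cases hi : i = j
          · subst hi; simp
          · simp [hi]
        rw [this]
        refine ih _ ?_ _ rfl _
        rw [← hm]
        refine Finset.card_lt_card ?_
        rw [Finset.ssubset_iff_of_subset]
        · exact ⟨j, by simpa using hj, by simp⟩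
        · intro i hi
          by_cases hij : i = j
          · subst hij
            exact absurd ⟨k, by simp⟩ (Finset.mem_filter.1 hi).2
          · simpa [hij] using hi
    choose r y hy hr using hcorr
    have hsum := Submodule.sum_mem (LinearMap.range P) (fun j (_ : j ∈ Finset.univ) => hy j)
    rw [Finset.sum_comm, Finset.sum_congr rfl fun j _ => hr j, Finset.sum_add_distrib,
      ← Finset.sum_smul] at hPG
    simp only [hE, TensorProduct.tmul_smul, ← hG, ← Finset.sum_smul] at hPG
    have hmem : P G ∈ LinearMap.range P := ⟨G, rfl⟩
    rw [hPG, ← add_assoc, ← add_smul] at hmem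
    have hne : (∑ k : Fin 3, (N k p : K) + ∑ j, (r j : K)) ≠ 0 := by
      have h5 := hpos p
      have h4 : ((∑ k : Fin 3, N k p + ∑ j, r j : ℕ) : K) ≠ 0 := by
        rw [Nat.cast_ne_zero]; omega
      simpa using h4
    exact cancel_mem _ hne hsum hmem
  rw [eq_top_iff]
  rintro z -
  induction z using TensorProduct.induction_on with
  | zero => exact Submodule.zero_mem _
  | add x y hx hy => exact Submodule.add_mem _ hx hy
  | tmul x w =>
    have hx : x ∈ Submodule.span K
        (Set.image (exteriorPower.ιMulti K (a + 1)) {v | Set.range v ⊆ Set.range mv}) := by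
      rw [exteriorPower.ιMulti_span_of_span K (a + 1) _ hmv]; trivial
    induction hx using Submodule.span_induction with
    | mem x hx =>
      obtain ⟨v, hv, rfl⟩ := hx
      have hv' : ∀ j, ∃ m, mv m = v j := fun j => hv ⟨j, rfl⟩
      choose m hm using hv'
      obtain rfl : (fun j => mv (m j)) = v := funext hm
      exact main _ m rfl w
    | zero => rw [TensorProduct.zero_tmul]; exact Submodule.zero_mem _
    | add x y _ _ hx hy => rw [TensorProduct.add_tmul]; exact Submodule.add_mem _ hx hy
    | smul r x _ hx => rw [← TensorProduct.smul_tmul']; exact Submodule.smul_mem _ _ hx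

lemma exact_gen {X Y Z : Type*} [AddCommMonoid X] [Module K X] [AddCommGroup Y] [Module K Y]
    [AddCommMonoid Z] [Module K Z] [Module.Finite K Y]
    (δ₁ : Y →ₗ[K] Z) (δ₂ : X →ₗ[K] Y) (g : Y →ₗ[K] X) (g' : Z →ₗ[K] Y)
    (hdd : δ₁ ∘ₗ δ₂ = 0) (hr : LinearMap.range (δ₂ ∘ₗ g + g' ∘ₗ δ₁) = ⊤) :
    LinearMap.ker δ₁ = LinearMap.range δ₂ := by
  apply le_antisymm
  · set P := δ₂ ∘ₗ g + g' ∘ₗ δ₁ with hP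
    have hsurj : Function.Surjective P := LinearMap.range_eq_top.1 hr
    have hinj : Function.Injective P := LinearMap.injective_iff_surjective.2 hsurj
    have hPz : ∀ z ∈ LinearMap.ker δ₁, P z = δ₂ (g z) := by
      intro z hz
      simp [hP, LinearMap.mem_ker.1 hz]
    have hZ : ∀ z ∈ LinearMap.ker δ₁, P z ∈ LinearMap.ker δ₁ := by
      intro z hz
      rw [hPz z hz]
      exact LinearMap.congr_fun hdd _
    have hs : Function.Surjective (P.restrict hZ) := by
      apply LinearMap.injective_iff_surjective.1
      intro x y hxy
      exact Subtype.ext (hinj (congrArg Subtype.val hxy))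
    intro z hz
    obtain ⟨y, hy⟩ := hs ⟨z, hz⟩
    have hy' : P y.1 = z := congrArg Subtype.val hy
    exact ⟨g y.1, by rw [← hPz _ y.2, hy']⟩
  · exact LinearMap.range_le_ker_iff.2 hdd

lemma exact_comb [CharZero K] [Module.Finite K V] [Module.Finite K B]
    {a : ℕ} {m₁ : V →ₗ[K] A →ₗ[K] B} {m₂ : V →ₗ[K] B →ₗ[K] C}
    (hm : ∀ s t w, m₂ t (m₁ s w) = m₂ s (m₁ t w))
    (t₁ : Fin 3 → B →ₗ[K] A) (t₂ : Fin 3 → C →ₗ[K] B)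
    {M I : Type*} (mv : M → V) (mb : I → B) (sq : Fin 3 → M)
    (hmv : Submodule.span K (Set.range mv) = ⊤) (hmb : Submodule.span K (Set.range mb) = ⊤)
    (N : Fin 3 → I → ℕ) (hE : ∀ k p, m₁ (mv (sq k)) (t₁ k (mb p)) = (N k p : K) • mb p)
    (hpos : ∀ p, 1 ≤ ∑ k : Fin 3, N k p)
    (hcom : ∀ k l p, t₂ k (m₂ (mv (sq l)) (mb p)) - m₁ (mv (sq l)) (t₁ k (mb p)) =
      if k = l then mb p else 0)
    {δ₁ : (⋀[K]^(a + 1) V) ⊗[K] B →ₗ[K] (⋀[K]^a V) ⊗[K] C}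
    {δ₂ : (⋀[K]^(a + 2) V) ⊗[K] A →ₗ[K] (⋀[K]^(a + 1) V) ⊗[K] B}
    (H₁ : IsK m₂ δ₁) (H₂ : IsK m₁ δ₂) : LinearMap.ker δ₁ = LinearMap.range δ₂ := by
  have hdd := dd_zero hm H₁ H₂
  have hr := P_surj t₁ t₂ mv mb sq hmv hmb N hE hpos hcom H₁ H₂
  exact exact_gen (X := (⋀[K]^(a + 2) V) ⊗[K] A) (Y := (⋀[K]^(a + 1) V) ⊗[K] B)
    (Z := (⋀[K]^a V) ⊗[K] C) δ₁ δ₂ _ _ hdd hr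

end GenericKoszul

section VK
variable {K : Type*} [Field K]

/-- Bilinear multiplication on homogeneous pieces. -/
noncomputable def mulL {b c : ℕ} (h : b + 2 = c) : S K 2 2 →ₗ[K] S K 2 b →ₗ[K] S K 2 c :=
  LinearMap.mk₂ K (fun s w => scast K h (mulSW K s w))
    (by intros; ext1; simp [scast, mulSW, add_mul])
    (by intros; ext1; simp [scast, mulSW])
    (by intros; ext1; simp [scast, mulSW, mul_add])
    (by intros; ext1; simp [scast, mulSW])

lemma mulL_coe {b c : ℕ} (h : b + 2 = c) (s : S K 2 2) (w : S K 2 b) :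
    (mulL h s w : MvPolynomial (Fin 3) K) = s * w := by
  simp [mulL, scast, mulSW]

/-- Divided partial derivative with respect to the square of the `k`-th variable. -/
noncomputable def tP (k : Fin 3) : MvPolynomial (Fin 3) K →ₗ[K] MvPolynomial (Fin 3) K :=
  (basisMonomials (Fin 3) K).constr K
    (fun p => monomial (p - Finsupp.single k 2) ((p k / 2 : ℕ) : K))

lemma tP_monomial (k : Fin 3) (p : Fin 3 →₀ ℕ) :
    tP k (monomial p (1 : K)) = monomial (p - Finsupp.single k 2) ((p k / 2 : ℕ) : K) := by
  have := (basisMonomials (Fin 3) K).constr_basis K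
    (fun p => monomial (p - Finsupp.single k 2) ((p k / 2 : ℕ) : K)) p
  simpa [tP] using this

lemma tP_mem (k : Fin 3) {e c : ℕ} (h : e + 2 = c) (w : MvPolynomial (Fin 3) K)
    (hw : w ∈ S K 2 c) : tP k w ∈ S K 2 e := by
  rw [w.as_sum, map_sum]
  refine Submodule.sum_mem _ fun p hp => ?_
  have hd : p.degree = c := by
    have := hw (mem_support_iff.1 hp)
    rwa [Finsupp.degree_eq_weight_one]
  rw [← mul_one (coeff p w), ← smul_eq_mul, ← smul_monomial, map_smul, tP_monomial]
  refine Submodule.smul_mem _ _ ?_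
  by_cases h2 : 2 ≤ p k
  · refine isHomogeneous_monomial _ ?_
    have : (p - Finsupp.single k 2) + Finsupp.single k 2 = p :=
      tsub_add_cancel_of_le (by simpa using h2)
    have h3 := congrArg Finsupp.degree this
    rw [map_add, Finsupp.degree_single] at h3
    omega
  · have : p k / 2 = 0 := by omega
    simp [this]

/-- Restriction of `tP` to homogeneous pieces. -/
noncomputable def tL (k : Fin 3) {e c : ℕ} (h : e + 2 = c) : S K 2 c →ₗ[K] S K 2 e :=
  (tP k).restrict (fun w hw => tP_mem k h w hw)

lemma tL_coe (k : Fin 3) {e c : ℕ} (h : e + 2 = c) (w : S K 2 c) :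
    (tL k h w : MvPolynomial (Fin 3) K) = tP k w := rfl

/-- Monomials as homogeneous elements. -/
noncomputable def mon {e : ℕ} (m : {m : Fin 3 →₀ ℕ // m.degree = e}) : S K 2 e :=
  ⟨monomial m.1 1, isHomogeneous_monomial _ m.2⟩

lemma span_mon (e : ℕ) : Submodule.span K (Set.range (mon (K := K) (e := e))) = ⊤ := by
  rw [eq_top_iff]
  rintro w -
  have : w = ∑ p ∈ (w : MvPolynomial (Fin 3) K).support.attach,
      coeff p.1 (w : MvPolynomial (Fin 3) K) • mon (K := K) (e := e) ⟨p.1, by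
        have := w.2 (mem_support_iff.1 p.2)
        rwa [Finsupp.degree_eq_weight_one]⟩ := by
    ext1
    rw [Submodule.coe_sum]
    conv_lhs => rw [(w : MvPolynomial (Fin 3) K).as_sum]
    rw [← Finset.sum_attach]
    refine Finset.sum_congr rfl fun p _ => ?_
    simp [mon, smul_monomial]
  rw [this]
  exact Submodule.sum_mem _ fun p _ => Submodule.smul_mem _ _ (Submodule.subset_span ⟨_, rfl⟩)

/-- The exponent of the square of the `k`-th variable. -/
noncomputable def sqE (k : Fin 3) : {m : Fin 3 →₀ ℕ // m.degree = 2} :=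
  ⟨Finsupp.single k 2, by simp⟩

lemma sqE_inj {k l : Fin 3} (h : sqE k = sqE l) : k = l := by
  have := congrArg Subtype.val h
  simp only [sqE] at this
  exact Finsupp.single_left_injective (by norm_num) this

lemma sq_tP (k : Fin 3) (p : Fin 3 →₀ ℕ) :
    monomial (Finsupp.single k 2) (1 : K) * tP k (monomial p 1) =
      ((p k / 2 : ℕ) : K) • monomial p 1 := by
  rw [tP_monomial, monomial_mul]
  by_cases h2 : 2 ≤ p k
  · rw [add_tsub_cancel_of_le (by simpa using h2)]; simp [smul_monomial]
  · have : p k / 2 = 0 := by omega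
    simp [this]

lemma com_sqP (k l : Fin 3) (p : Fin 3 →₀ ℕ) :
    tP k (monomial (Finsupp.single l 2) (1 : K) * monomial p 1) -
      monomial (Finsupp.single l 2) (1 : K) * tP k (monomial p 1) =
      if k = l then monomial p 1 else 0 := by
  split_ifs with hkl
  · subst hkl
    rw [sq_tP, monomial_mul, mul_one, tP_monomial, add_tsub_cancel_left]
    have : ((Finsupp.single k 2 + p : Fin 3 →₀ ℕ) k) / 2 = p k / 2 + 1 := by simp
    rw [this]
    simp [smul_monomial]
  · rw [monomial_mul, mul_one, tP_monomial, tP_monomial, monomial_mul]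
    have h1 : (Finsupp.single l 2 + p : Fin 3 →₀ ℕ) k = p k := by simp [Ne.symm hkl]
    rw [h1]
    by_cases h2 : 2 ≤ p k
    · rw [add_tsub_assoc_of_le (by simpa using h2)]; simp
    · have : p k / 2 = 0 := by omega
      simp [this]

lemma com_sq (k l : Fin 3) {e c f : ℕ} (h : e + 2 = c) (h' : c + 2 = f)
    (p : {m : Fin 3 →₀ ℕ // m.degree = c}) :
    tL k h' (mulL h' (mon (K := K) (sqE l)) (mon p)) -
      mulL h (mon (K := K) (sqE l)) (tL k h (mon p)) = if k = l then mon p else 0 := by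
  apply Subtype.ext
  have h0 := com_sqP (K := K) k l p.1
  rw [Submodule.coe_sub, tL_coe, mulL_coe, mulL_coe, tL_coe]
  refine h0.trans ?_
  split_ifs <;> rfl

lemma sq_tL (k : Fin 3) {e c : ℕ} (h : e + 2 = c) (p : {m : Fin 3 →₀ ℕ // m.degree = c}) :
    mulL h (mon (K := K) (sqE k)) (tL k h (mon p)) = ((p.1 k / 2 : ℕ) : K) • mon p := by
  apply Subtype.ext
  rw [mulL_coe, tL_coe]
  exact sq_tP k p.1

lemma exact_main [CharZero K] {a e c f : ℕ} (h : e + 2 = c) (h' : c + 2 = f) (hc : 4 ≤ c)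
    {δ₁ : (⋀[K]^(a + 1) (S K 2 2)) ⊗[K] S K 2 c →ₗ[K] (⋀[K]^a (S K 2 2)) ⊗[K] S K 2 f}
    {δ₂ : (⋀[K]^(a + 2) (S K 2 2)) ⊗[K] S K 2 e →ₗ[K] (⋀[K]^(a + 1) (S K 2 2)) ⊗[K] S K 2 c}
    (H₁ : IsK (mulL h') δ₁) (H₂ : IsK (mulL h) δ₂) :
    LinearMap.ker δ₁ = LinearMap.range δ₂ := by
  have hfin : ∀ e, Module.Finite K (S K 2 e) := fun e =>
    Module.Finite.iff_fg.2 (homogeneousSubmodule_fg (Fin 3) K e)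
  have h1 := hfin 2
  have h2 := hfin c
  refine exact_comb ?_ (fun k => tL k h) (fun k => tL k h') mon mon sqE (span_mon 2) (span_mon c)
    (fun k p => p.1 k / 2) (fun k p => sq_tL k h p) ?_ (fun k l p => com_sq k l h h' p) H₁ H₂
  · intro s t w
    apply Subtype.ext
    simp only [mulL_coe]
    ring
  · intro p
    have hd := p.2
    rw [Finsupp.degree_eq_sum] at hd
    simp only [Fin.sum_univ_three] at hd ⊢
    omega

lemma skipAt_eq {a : ℕ} (j : Fin (a + 1)) (i : Fin a) :
    skipAt j i = j.succAbove i := by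
  unfold skipAt Fin.succAbove
  by_cases h : (i : ℕ) < (j : ℕ)
  · have h' : i.castSucc < j := h
    rw [if_pos h, if_pos h']; rfl
  · have h' : ¬ i.castSucc < j := h
    rw [if_neg h, if_neg h']; rfl

lemma sign_smul (j : ℕ) {N : Type*} [AddCommGroup N] [Module K N] (x : N) :
    ((-1 : K) ^ j) • x = ((-1 : ℤ) ^ j) • x := by
  rw [← Int.cast_smul_eq_zsmul K]; simp

lemma wedge_skip {a : ℕ} (v : Fin (a + 1) → S K 2 2) (j : Fin (a + 1)) :
    (wedge K a fun i => v (skipAt j i)) = exteriorPower.ιMulti K a (j.removeNth v) := by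
  have : (fun i => v (skipAt j i)) = j.removeNth v :=
    funext fun l => congrArg v (skipAt_eq j l)
  exact congrArg (exteriorPower.ιMulti K a) this

lemma isK_of {a b : ℕ}
    {δ : (⋀[K]^(a + 1) (S K 2 2)) ⊗[K] S K 2 b →ₗ[K] (⋀[K]^a (S K 2 2)) ⊗[K] S K 2 (b + 2)}
    (H : IsKoszulMap K 2 2 (a + 1) b δ) : IsK (mulL rfl) δ := by
  intro v w
  refine (H v w).trans (Finset.sum_congr rfl fun j _ => ?_)
  refine (sign_smul (K := K) (j : ℕ)
    (N := (⋀[K]^a (S K 2 2)) ⊗[K] S K 2 (b + 2)) _).trans ?_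
  congr 1

lemma isK_cast {a b c : ℕ} (h : b + 2 = c)
    {δ : (⋀[K]^(a + 1) (S K 2 2)) ⊗[K] S K 2 b →ₗ[K] (⋀[K]^a (S K 2 2)) ⊗[K] S K 2 (b + 2)}
    (H : IsK (mulL rfl) δ) :
    IsK (mulL h) ((TensorProduct.congr (LinearEquiv.refl K (⋀[K]^a (S K 2 2)))
      (scast K h)).toLinearMap ∘ₗ δ) := by
  intro v w
  rw [LinearMap.comp_apply, H v w, map_sum]
  refine Finset.sum_congr rfl fun j _ => ?_
  rw [map_zsmul]
  rfl

end VK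

/-- for `n = 2`, `d = 2`, the Veronese–Koszul complex at `(i,q)` is exact for all
`i ≥ 1` and `q ≥ 2` (the Veronese surface in `P^5` satisfies `N_p` for every `p`). -/
theorem stmt9 (K : Type*) [Field K] [CharZero K] :
    ∀ i, 1 ≤ i → ∀ q, 2 ≤ q → VKExact K 2 2 i q := by
  intro i hi q hq h δ₁ δ₂ H₁ H₂
  obtain ⟨a, rfl⟩ : ∃ a, i = a + 1 := ⟨i - 1, by omega⟩
  exact exact_main (a := a) h rfl (by omega) (isK_of H₁) (isK_cast h (isK_of H₂))
end

section
/- Let Q_1 = Y_{00}Y_{11} − Y_{01}^2, Q_2 = Y_{00}Y_{22} − Y_{02}^2, Q_3 = Y_{11}Y_{22} − Y_{12}^2, Q_4 = Y_{00}Y_{12} − Y_{01}Y_{02}, Q_5 = Y_{11}Y_{02} − Y_{01}Y_{12}, Q_6 = Y_{22}Y_{01} − Y_{02}Y_{12} in R. Then the kernel of the R-module map R^6 → R sending the i-th standard basis vector to Q_i is generated, as an R-module, by elements all of whose six components are homogeneous polynomials of degree 1. (That is, the module of syzygies among the quadratic generators of the ideal of the Veronese surface in P^5 is spanned by linear syzygies.)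 -/
noncomputable section

open MvPolynomial

/-- The six quadrics `Q_1, …, Q_6` generating the ideal of the Veronese surface in `P^5`,
in the ring `R = K[Y_00,Y_01,Y_02,Y_11,Y_12,Y_22]` with variables indexed
`0 ↦ Y_00, 1 ↦ Y_01, 2 ↦ Y_02, 3 ↦ Y_11, 4 ↦ Y_12, 5 ↦ Y_22`. -/
def veroneseQuadric (K : Type*) [Field K] : Fin 6 → MvPolynomial (Fin 6) K :=
  ![X 0 * X 3 - X 1 ^ 2,   -- Q₁ = Y₀₀Y₁₁ − Y₀₁²
    X 0 * X 5 - X 2 ^ 2,   -- Q₂ = Y₀₀Y₂₂ − Y₀₂²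
    X 3 * X 5 - X 4 ^ 2,   -- Q₃ = Y₁₁Y₂₂ − Y₁₂²
    X 0 * X 4 - X 1 * X 2, -- Q₄ = Y₀₀Y₁₂ − Y₀₁Y₀₂
    X 3 * X 2 - X 1 * X 4, -- Q₅ = Y₁₁Y₀₂ − Y₀₁Y₁₂
    X 5 * X 1 - X 2 * X 4] -- Q₆ = Y₂₂Y₀₁ − Y₀₂Y₁₂

/-- The `R`-module map `R^6 → R` sending the `i`-th standard basis vector to `Q_i`. -/
def quadricRelationMap (K : Type*) [Field K] :
    (Fin 6 → MvPolynomial (Fin 6) K) →ₗ[MvPolynomial (Fin 6) K] MvPolynomial (Fin 6) K where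
  toFun v := ∑ i, v i * veroneseQuadric K i
  map_add' v₁ v₂ := by simp [add_mul, Finset.sum_add_distrib]
  map_smul' c v := by simp [Finset.mul_sum, mul_assoc]

open MvPolynomial

namespace VeroneseSyz

variable (K : Type*) [Field K]

abbrev R := MvPolynomial (Fin 6) K

/-- span of the linear syzygies -/
def L : Submodule (R K) (Fin 6 → R K) :=
  Submodule.span (MvPolynomial (Fin 6) K)
        {v : Fin 6 → MvPolynomial (Fin 6) K |
          v ∈ LinearMap.ker (quadricRelationMap K) ∧ ∀ i, (v i).IsHomogeneous 1}

/-- `K[a,d,e,f]` -/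
def S1 : Subalgebra K (R K) := Algebra.adjoin K {X 0, X 3, X 5, X 4}
/-- `K[a,c,d,e,f]` -/
def S2 : Subalgebra K (R K) := Algebra.adjoin K {X 0, X 3, X 5, X 4, X 2}

lemma S1_le : S1 K ≤ S2 K := by
  apply Algebra.adjoin_mono
  intro x hx
  simp only [Set.mem_insert_iff, Set.mem_singleton_iff] at hx ⊢
  tauto

/-- normal forms -/
def P : Submodule K (Fin 6 → R K) where
  carrier := {v | v 1 ∈ S2 K ∧ v 3 ∈ S2 K ∧ v 2 ∈ S1 K ∧ v 4 ∈ S1 K ∧ v 5 ∈ S1 K}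
  add_mem' := by
    rintro v w ⟨h1, h2, h3, h4, h5⟩ ⟨k1, k2, k3, k4, k5⟩
    exact ⟨add_mem h1 k1, add_mem h2 k2, add_mem h3 k3, add_mem h4 k4, add_mem h5 k5⟩
  zero_mem' := ⟨zero_mem _, zero_mem _, zero_mem _, zero_mem _, zero_mem _⟩
  smul_mem' := by
    rintro c v ⟨h1, h2, h3, h4, h5⟩
    exact ⟨Subalgebra.smul_mem _ h1 c, Subalgebra.smul_mem _ h2 c, Subalgebra.smul_mem _ h3 c,
      Subalgebra.smul_mem _ h4 c, Subalgebra.smul_mem _ h5 c⟩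

def N : Submodule K (Fin 6 → R K) := (L K).restrictScalars K ⊔ P K

/-- stabilizer of `N` -/
def T : Subalgebra K (R K) where
  carrier := {r | ∀ n ∈ N K, r • n ∈ N K}
  mul_mem' := by
    intro a b ha hb n hn
    rw [mul_smul]
    exact ha _ (hb _ hn)
  add_mem' := by
    intro a b ha hb n hn
    rw [add_smul]
    exact add_mem (ha _ hn) (hb _ hn)
  algebraMap_mem' := by
    intro k n hn
    rw [algebraMap_smul]
    exact Submodule.smul_mem _ k hn

variable {K}

lemma L_le {v : Fin 6 → R K} (h : v ∈ L K) : v ∈ N K :=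
  Submodule.mem_sup_left (S := (L K).restrictScalars K) h
lemma P_le {v : Fin 6 → R K} (h : v ∈ P K) : v ∈ N K :=
  Submodule.mem_sup_right h

lemma mem_T_of {r : R K} (h : ∀ v ∈ P K, r • v ∈ N K) : r ∈ T K := by
  intro n hn
  obtain ⟨l, hl, p, hp, rfl⟩ := Submodule.mem_sup.1 hn
  rw [smul_add]
  exact add_mem (L_le ((L K).smul_mem r hl)) (h p hp)

lemma mem_T_S1 {r : R K} (h : r ∈ S1 K) : r ∈ T K := by
  apply mem_T_of
  rintro v ⟨h1, h2, h3, h4, h5⟩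
  exact P_le ⟨mul_mem (S1_le K h) h1, mul_mem (S1_le K h) h2, mul_mem h h3, mul_mem h h4,
    mul_mem h h5⟩

lemma x0 : (X 0 : R K) ∈ S1 K := Algebra.subset_adjoin (by simp)
lemma x3 : (X 3 : R K) ∈ S1 K := Algebra.subset_adjoin (by simp)
lemma x5 : (X 5 : R K) ∈ S1 K := Algebra.subset_adjoin (by simp)
lemma x4 : (X 4 : R K) ∈ S1 K := Algebra.subset_adjoin (by simp)
lemma x2 : (X 2 : R K) ∈ S2 K := Algebra.subset_adjoin (by simp)

lemma mem_L (v : Fin 6 → R K) (hv : ∑ i, v i * veroneseQuadric K i = 0)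
    (h : ∀ i, (v i).IsHomogeneous 1) : v ∈ L K :=
  Submodule.subset_span ⟨LinearMap.mem_ker.2 hv, h⟩

lemma syz1 : (![0, X 3, -X 0, -X 4, X 2, 0] : Fin 6 → R K) ∈ L K := by
  apply mem_L
  · simp [Fin.sum_univ_six, veroneseQuadric]
    ring
  · intro i
    fin_cases i <;> simp [isHomogeneous_X, isHomogeneous_zero, IsHomogeneous.neg]

lemma syz2 : (![0, -X 4, 0, X 5, 0, X 2] : Fin 6 → R K) ∈ L K := by
  apply mem_L
  · simp [Fin.sum_univ_six, veroneseQuadric]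
    ring
  · intro i
    fin_cases i <;> simp [isHomogeneous_X, isHomogeneous_zero, IsHomogeneous.neg]

lemma syz3 : (![0, 0, X 2, 0, -X 5, -X 4] : Fin 6 → R K) ∈ L K := by
  apply mem_L
  · simp [Fin.sum_univ_six, veroneseQuadric]
    ring
  · intro i
    fin_cases i <;> simp [isHomogeneous_X, isHomogeneous_zero, IsHomogeneous.neg]

lemma syz4 : (![-X 2, 0, 0, X 1, X 0, 0] : Fin 6 → R K) ∈ L K := by
  apply mem_L
  · simp [Fin.sum_univ_six, veroneseQuadric]
    ring
  · intro i
    fin_cases i <;> simp [isHomogeneous_X, isHomogeneous_zero, IsHomogeneous.neg]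

lemma syz5 : (![-X 4, 0, 0, X 3, X 1, 0] : Fin 6 → R K) ∈ L K := by
  apply mem_L
  · simp [Fin.sum_univ_six, veroneseQuadric]
    ring
  · intro i
    fin_cases i <;> simp [isHomogeneous_X, isHomogeneous_zero, IsHomogeneous.neg]

lemma syz6 : (![0, X 1, 0, -X 2, 0, -X 0] : Fin 6 → R K) ∈ L K := by
  apply mem_L
  · simp [Fin.sum_univ_six, veroneseQuadric]
    ring
  · intro i
    fin_cases i <;> simp [isHomogeneous_X, isHomogeneous_zero, IsHomogeneous.neg]

lemma syz7 : (![X 5, 0, -X 0, -X 4, 0, X 1] : Fin 6 → R K) ∈ L K := by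
  apply mem_L
  · simp [Fin.sum_univ_six, veroneseQuadric]
    ring
  · intro i
    fin_cases i <;> simp [isHomogeneous_X, isHomogeneous_zero, IsHomogeneous.neg]

lemma syz8 : (![0, 0, X 1, 0, -X 4, -X 3] : Fin 6 → R K) ∈ L K := by
  apply mem_L
  · simp [Fin.sum_univ_six, veroneseQuadric]
    ring
  · intro i
    fin_cases i <;> simp [isHomogeneous_X, isHomogeneous_zero, IsHomogeneous.neg]

lemma c_mem : (X 2 : R K) ∈ T K := by
  apply mem_T_of
  rintro v ⟨h1, h2, h3, h4, h5⟩
  have e : (X 2 : R K) • v = (v 4 • ![0, X 3, -X 0, -X 4, X 2, 0] + v 5 • ![0, -X 4, 0, X 5, 0, X 2]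
      + v 2 • ![0, 0, X 2, 0, -X 5, -X 4]) +
      ![X 2 * v 0, X 2 * v 1 - v 4 * X 3 + v 5 * X 4, v 4 * X 0, X 2 * v 3 + v 4 * X 4 - v 5 * X 5,
        v 2 * X 5, v 2 * X 4] := by
    ext1 i
    fin_cases i <;> simp <;> ring
  rw [e]
  refine add_mem (L_le (add_mem (add_mem ?_ ?_) ?_)) (P_le ⟨?_, ?_, ?_, ?_, ?_⟩)
  · exact Submodule.smul_mem _ _ syz1
  · exact Submodule.smul_mem _ _ syz2
  · exact Submodule.smul_mem _ _ syz3
  · exact add_mem (sub_mem (mul_mem x2 h1) (S1_le K (mul_mem h4 x3))) (S1_le K (mul_mem h5 x4))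
  · exact sub_mem (add_mem (mul_mem x2 h2) (S1_le K (mul_mem h4 x4))) (S1_le K (mul_mem h5 x5))
  · exact mul_mem h4 x0
  · exact mul_mem h3 x5
  · exact mul_mem h3 x4

lemma mem_T_S2 {r : R K} (h : r ∈ S2 K) : r ∈ T K := by
  refine (Algebra.adjoin_le ?_ : S2 K ≤ T K) h
  rintro x (rfl | rfl | rfl | rfl | rfl)
  exacts [mem_T_S1 x0, mem_T_S1 x3, mem_T_S1 x5, mem_T_S1 x4, c_mem]

lemma b_mem : (X 1 : R K) ∈ T K := by
  apply mem_T_of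
  rintro v ⟨h1, h2, h3, h4, h5⟩
  have e : (X 1 : R K) • v = (v 3 • ![-X 2, 0, 0, X 1, X 0, 0] + v 4 • ![-X 4, 0, 0, X 3, X 1, 0]
      + v 1 • ![0, X 1, 0, -X 2, 0, -X 0] + v 5 • ![X 5, 0, -X 0, -X 4, 0, X 1]
      + v 2 • ![0, 0, X 1, 0, -X 4, -X 3]) +
      ((v 3 • ![0, 0, 0, 0, -X 0, 0] + v 1 • ![0, 0, 0, 0, 0, X 0]) +
      ![X 1 * v 0 + X 2 * v 3 + X 4 * v 4 - X 5 * v 5, 0, v 5 * X 0,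
        X 2 * v 1 - v 4 * X 3 + v 5 * X 4, v 2 * X 4, v 2 * X 3]) := by
    ext1 i
    fin_cases i <;> simp <;> ring
  rw [e]
  refine add_mem (L_le (add_mem (add_mem (add_mem (add_mem ?_ ?_) ?_) ?_) ?_))
    (add_mem (add_mem ?_ ?_) (P_le ⟨?_, ?_, ?_, ?_, ?_⟩))
  · exact Submodule.smul_mem _ _ syz4
  · exact Submodule.smul_mem _ _ syz5
  · exact Submodule.smul_mem _ _ syz6
  · exact Submodule.smul_mem _ _ syz7
  · exact Submodule.smul_mem _ _ syz8
  · exact mem_T_S2 h2 _ (P_le ⟨zero_mem _, zero_mem _, zero_mem _, neg_mem x0, zero_mem _⟩)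
  · exact mem_T_S2 h1 _ (P_le ⟨zero_mem _, zero_mem _, zero_mem _, zero_mem _, x0⟩)
  · exact zero_mem _
  · exact add_mem (sub_mem (mul_mem x2 h1) (S1_le K (mul_mem h4 x3))) (S1_le K (mul_mem h5 x4))
  · exact mul_mem h5 x0
  · exact mul_mem h3 x4
  · exact mul_mem h3 x3

lemma T_top (r : R K) : r ∈ T K := by
  have : (⊤ : Subalgebra K (R K)) ≤ T K := by
    rw [← MvPolynomial.adjoin_range_X]
    apply Algebra.adjoin_le
    rintro _ ⟨i, rfl⟩
    fin_cases i
    exacts [mem_T_S1 x0, b_mem, c_mem, mem_T_S1 x3, mem_T_S1 x4, mem_T_S1 x5]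
  exact this trivial

lemma N_top (v : Fin 6 → R K) : v ∈ N K := by
  have : v = ∑ i, v i • (Pi.single i 1 : Fin 6 → R K) := by
    ext1 j
    simp [Finset.sum_apply, Pi.single_apply]
  rw [this]
  refine sum_mem fun i _ => T_top _ _ (P_le ?_)
  have h : ∀ (S : Subalgebra K (R K)) (j : Fin 6), (Pi.single i 1 : Fin 6 → R K) j ∈ S := by
    intro S j
    rw [Pi.single_apply]
    split_ifs
    exacts [one_mem _, zero_mem _]
  exact ⟨h _ _, h _ _, h _ _, h _ _, h _ _⟩

lemma poly_lem {D : Type*} [CommRing D] [IsDomain D] (α u w : D) (p : Polynomial D)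
    (h : p * (Polynomial.C α - Polynomial.X ^ 2) + Polynomial.C u * Polynomial.X
      + Polynomial.C w = 0) : p = 0 ∧ u = 0 ∧ w = 0 := by
  have hp : p = 0 := by
    by_contra hp
    have h2 : p * (Polynomial.X ^ 2 - Polynomial.C α)
        = Polynomial.C u * Polynomial.X + Polynomial.C w := by linear_combination -h
    have h3 := congrArg Polynomial.natDegree h2
    rw [Polynomial.natDegree_mul hp (Polynomial.X_pow_sub_C_ne_zero (by norm_num) α),
      Polynomial.natDegree_X_pow_sub_C] at h3
    have := Polynomial.natDegree_linear_le (a := u) (b := w)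
    omega
  subst hp
  refine ⟨rfl, ?_, ?_⟩
  · simpa using congrArg (fun q => Polynomial.coeff q 1) h
  · simpa using congrArg (fun q => Polynomial.coeff q 0) h

lemma poly_lem2 {D : Type*} [CommRing D] (w : D) (p : Polynomial D)
    (h : p * Polynomial.X + Polynomial.C w = 0) : p = 0 ∧ w = 0 := by
  have hw : w = 0 := by simpa using congrArg (fun q => Polynomial.coeff q 0) h
  subst hw
  refine ⟨?_, rfl⟩
  ext n
  simpa using congrArg (fun q => Polynomial.coeff q (n+1)) h

open scoped Polynomial in
lemma uniq {B : Type*} [CommRing B] [IsDomain B] (a d f : B) (v0 : B[X][X][X]) (v1 v3 : B[X][X])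
    (v2 v4 v5 : B[X])
    (h : v0 * (Polynomial.C (Polynomial.C (Polynomial.C a)) * Polynomial.C (Polynomial.C (Polynomial.C d)) - Polynomial.X ^ 2) + Polynomial.C v1 * (Polynomial.C (Polynomial.C (Polynomial.C a)) * Polynomial.C (Polynomial.C (Polynomial.C f)) - Polynomial.C Polynomial.X ^ 2)
      + Polynomial.C (Polynomial.C v2) * (Polynomial.C (Polynomial.C (Polynomial.C d)) * Polynomial.C (Polynomial.C (Polynomial.C f)) - Polynomial.C (Polynomial.C Polynomial.X) ^ 2)
      + Polynomial.C v3 * (Polynomial.C (Polynomial.C (Polynomial.C a)) * Polynomial.C (Polynomial.C Polynomial.X) - Polynomial.X * Polynomial.C Polynomial.X)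
      + Polynomial.C (Polynomial.C v4) * (Polynomial.C (Polynomial.C (Polynomial.C d)) * Polynomial.C Polynomial.X - Polynomial.X * Polynomial.C (Polynomial.C Polynomial.X))
      + Polynomial.C (Polynomial.C v5) * (Polynomial.C (Polynomial.C (Polynomial.C f)) * Polynomial.X - Polynomial.C Polynomial.X * Polynomial.C (Polynomial.C Polynomial.X)) = 0) :
    v0 = 0 ∧ v1 = 0 ∧ v2 = 0 ∧ v3 = 0 ∧ v4 = 0 ∧ v5 = 0 := by
  obtain ⟨h0, hu, hw⟩ := poly_lem (Polynomial.C (Polynomial.C a) * Polynomial.C (Polynomial.C d))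
    (-v3 * Polynomial.X - Polynomial.C v4 * Polynomial.C Polynomial.X + Polynomial.C v5 * Polynomial.C (Polynomial.C f))
    (v1 * (Polynomial.C (Polynomial.C a) * Polynomial.C (Polynomial.C f) - Polynomial.X ^ 2) + Polynomial.C v2 * (Polynomial.C (Polynomial.C d) * Polynomial.C (Polynomial.C f) - Polynomial.C Polynomial.X ^ 2)
      + v3 * (Polynomial.C (Polynomial.C a) * Polynomial.C Polynomial.X) + Polynomial.C v4 * (Polynomial.C (Polynomial.C d) * Polynomial.X) - Polynomial.C v5 * (Polynomial.X * Polynomial.C Polynomial.X)) v0 (by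
      simp only [map_add, map_sub, map_mul, map_pow, map_neg]
      refine Eq.trans ?_ h
      ring)
  obtain ⟨h3, hu'⟩ := poly_lem2 (- v4 * Polynomial.X + v5 * Polynomial.C f) (-v3) (by
      simp only [map_add, map_sub, map_mul, map_pow, map_neg]
      linear_combination hu)
  have h3 : v3 = 0 := by simpa using h3
  subst h3
  obtain ⟨h1, hx, hy⟩ := poly_lem (Polynomial.C a * Polynomial.C f) (v4 * Polynomial.C d - v5 * Polynomial.X)
    (v2 * (Polynomial.C d * Polynomial.C f - Polynomial.X ^ 2)) v1 (by
      simp only [map_add, map_sub, map_mul, map_pow, map_neg]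
      linear_combination hw)
  have hne : (Polynomial.C d * Polynomial.C f - Polynomial.X ^ 2 : B[X]) ≠ 0 := by
    intro h
    apply Polynomial.X_pow_sub_C_ne_zero (by norm_num : 0 < 2) (d * f)
    rw [map_mul]
    linear_combination -h
  refine ⟨h0, h1, (mul_eq_zero.1 hy).resolve_right hne, rfl, ?_, ?_⟩
  · refine (mul_eq_zero.1 (?_ : v4 * (Polynomial.C d * Polynomial.C f - Polynomial.X ^ 2) = 0)).resolve_right hne
    linear_combination Polynomial.C f * hx + Polynomial.X * hu'
  · refine (mul_eq_zero.1 (?_ : v5 * (Polynomial.C d * Polynomial.C f - Polynomial.X ^ 2) = 0)).resolve_right hne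
    linear_combination Polynomial.C d * hu' + Polynomial.X * hx

section
set_option synthInstance.maxHeartbeats 1000000
set_option maxHeartbeats 2000000
set_option maxSynthPendingDepth 6
set_option synthInstance.maxSize 2000
variable (K)

abbrev B := MvPolynomial (Fin 3) K

def Phi : R K →ₐ[K] Polynomial (Polynomial (Polynomial (B K))) :=
  MvPolynomial.aeval (R := K) (![Polynomial.C (Polynomial.C (Polynomial.C (X 0))), Polynomial.X, Polynomial.C Polynomial.X, Polynomial.C (Polynomial.C (Polynomial.C (X 1))),
    Polynomial.C (Polynomial.C Polynomial.X), Polynomial.C (Polynomial.C (Polynomial.C (X 2)))] : Fin 6 → Polynomial (Polynomial (Polynomial (B K))))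

def Psi : Polynomial (Polynomial (Polynomial (B K))) →+* R K :=
  Polynomial.eval₂RingHom (Polynomial.eval₂RingHom (Polynomial.eval₂RingHom
    (MvPolynomial.aeval (R := K) ![X 0, X 3, X 5] : B K →ₐ[K] R K).toRingHom (X 4)) (X 2)) (X 1)

lemma Phi_inj : Function.Injective (Phi K) := by
  have : (Psi K).comp (Phi K).toRingHom = RingHom.id _ := by
    apply MvPolynomial.ringHom_ext
    · intro r
      simp [Phi, Psi, Polynomial.algebraMap_apply, MvPolynomial.algebraMap_eq]
    · intro i
      fin_cases i <;> simp [Phi, Psi]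
  intro x y hxy
  have h := congrArg (Psi K) hxy
  have e : ∀ z, Psi K (Phi K z) = z := fun z => RingHom.congr_fun this z
  rwa [e, e] at h

variable {K}

lemma S1_img {r : R K} (h : r ∈ S1 K) : ∃ q, Phi K r = Polynomial.C (Polynomial.C q) := by
  induction h using Algebra.adjoin_induction with
  | mem x hx =>
    obtain (rfl | rfl | rfl | rfl) := hx
    · exact ⟨Polynomial.C (X 0), by simp [Phi]⟩
    · exact ⟨Polynomial.C (X 1), by simp [Phi]⟩
    · exact ⟨Polynomial.C (X 2), by simp [Phi]⟩
    · exact ⟨Polynomial.X, by simp [Phi]⟩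
  | algebraMap r => exact ⟨algebraMap K _ r, by simp only [AlgHom.commutes]; rfl⟩
  | add x y _ _ hx hy =>
    obtain ⟨p, hp⟩ := hx
    obtain ⟨q, hq⟩ := hy
    exact ⟨p + q, by simp [hp, hq]⟩
  | mul x y _ _ hx hy =>
    obtain ⟨p, hp⟩ := hx
    obtain ⟨q, hq⟩ := hy
    exact ⟨p * q, by simp [hp, hq]⟩

lemma S2_img {r : R K} (h : r ∈ S2 K) : ∃ q, Phi K r = Polynomial.C q := by
  induction h using Algebra.adjoin_induction with
  | mem x hx =>
    obtain (rfl | rfl | rfl | rfl | rfl) := hx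
    · exact ⟨Polynomial.C (Polynomial.C (X 0)), by simp [Phi]⟩
    · exact ⟨Polynomial.C (Polynomial.C (X 1)), by simp [Phi]⟩
    · exact ⟨Polynomial.C (Polynomial.C (X 2)), by simp [Phi]⟩
    · exact ⟨Polynomial.C Polynomial.X, by simp [Phi]⟩
    · exact ⟨Polynomial.X, by simp [Phi]⟩
  | algebraMap r => exact ⟨algebraMap K _ r, by simp only [AlgHom.commutes]; rfl⟩
  | add x y _ _ hx hy =>
    obtain ⟨p, hp⟩ := hx
    obtain ⟨q, hq⟩ := hy
    exact ⟨p + q, by simp [hp, hq]⟩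
  | mul x y _ _ hx hy =>
    obtain ⟨p, hp⟩ := hx
    obtain ⟨q, hq⟩ := hy
    exact ⟨p * q, by simp [hp, hq]⟩

lemma P_ker {v : Fin 6 → R K} (hv : v ∈ P K) (hk : quadricRelationMap K v = 0) : v = 0 := by
  obtain ⟨h1, h3, h2, h4, h5⟩ := hv
  obtain ⟨q1, e1⟩ := S2_img h1
  obtain ⟨q3, e3⟩ := S2_img h3
  obtain ⟨q2, e2⟩ := S1_img h2
  obtain ⟨q4, e4⟩ := S1_img h4
  obtain ⟨q5, e5⟩ := S1_img h5
  have hk' : ∑ i, v i * veroneseQuadric K i = 0 := hk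
  have hk2 := congrArg (Phi K) hk'
  simp only [Fin.sum_univ_six, map_add, map_mul, e1, e2, e3, e4, e5, map_zero] at hk2
  obtain ⟨z0, z1, z2, z3, z4, z5⟩ := uniq (X 0 : B K) (X 1) (X 2) (Phi K (v 0)) q1 q3 q2 q4 q5 (by
    rw [← hk2]
    simp [veroneseQuadric, Phi, -Polynomial.X_mul_C])
  ext1 i
  apply Phi_inj K
  rw [Pi.zero_apply, map_zero]
  fin_cases i
  · exact z0
  · exact e1.trans (by rw [z1, map_zero])
  · exact e2.trans (by rw [z2, map_zero, map_zero])
  · exact e3.trans (by rw [z3, map_zero])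
  · exact e4.trans (by rw [z4, map_zero, map_zero])
  · exact e5.trans (by rw [z5, map_zero, map_zero])

end

end VeroneseSyz

/-- the kernel of `R^6 → R`, `e_i ↦ Q_i`, is generated as an `R`-module by
syzygies all of whose six components are homogeneous of degree `1` (linear syzygies). -/
theorem stmt11 (K : Type*) [Field K] [CharZero K] :
    LinearMap.ker (quadricRelationMap K) =
      Submodule.span (MvPolynomial (Fin 6) K)
        {v : Fin 6 → MvPolynomial (Fin 6) K |
          v ∈ LinearMap.ker (quadricRelationMap K) ∧ ∀ i, (v i).IsHomogeneous 1} := by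
  apply le_antisymm
  · intro v hv
    change v ∈ VeroneseSyz.L K
    obtain ⟨l, hl, p, hp, rfl⟩ := Submodule.mem_sup.1 (VeroneseSyz.N_top v)
    have hlk : l ∈ LinearMap.ker (quadricRelationMap K) := by
      refine (Submodule.span_le.2 ?_ : VeroneseSyz.L K ≤ _) hl
      exact fun w hw => hw.1
    have hpk : p ∈ LinearMap.ker (quadricRelationMap K) := by
      simpa using sub_mem hv hlk
    rw [VeroneseSyz.P_ker hp (LinearMap.mem_ker.1 hpk), add_zero]
    exact hl
  · exact Submodule.span_le.2 fun w hw => hw.1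


end
end
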